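/- Let u be a weak supersolution of ∂ₜu + 𝓛u = Δu in Ω × (0,T) with u ≥ 0 on B_R(x₀) × (t₀ − r², t₀ + r²), where B_R(x₀) × (t₀ − r², t₀ + r²) ⊂ Ω × (0,T), 0 < r ≤ 1 and r < R/2. Let d > 0 and set v = u + l with l = (r/R)² · Tail_∞(u₋; x₀, R, t₀ − r², t₀ + r²) + d. Let C₀ > 0 and let ψ ∈ C_c^∞(B_{3r/2}(x₀)) be nonnegative, radially decreasing about x₀ (i.e. ψ(x) = g(|x − x₀|) with g nonincreasing), with 0 ≤ ψ ≤ 1, ψ ≡ 1 on B_r(x₀) and |∇ψ| ≤ C₀/r on B_{3r/2}(x₀). Define b = − ( ∫_{B_{3r/2}(x₀)} log v(x, t₀) ψ(x)² dx ) / ( ∫_{B_{3r/2}(x₀)} ψ(x)² dx ). Then there exists a constant C > 0 depending only on N, s, Λ and C₀ such that for every λ > 0: |{ (x,t) ∈ B_r(x₀) × (t₀ − r², t₀) : log v(x,t) > λ − b }| ≤ C r^{N+2} / λ. -/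

import Mathlib

open MeasureTheory Metric Set
open scoped RealInnerProductSpace ENNReal

noncomputable section

/-- Euclidean space `ℝ^N`. -/
abbrev E (N : ℕ) : Type := EuclideanSpace ℝ (Fin N)

/-- The kernel `K` is measurable, symmetric in its first two arguments, and comparable to
the fractional kernel `|x-y|^{-(N+2s)}` with constant `Λ`, uniformly for `t ∈ (0,T)`. -/
def KernelOK (N : ℕ) (s Λ T : ℝ) (K : E N → E N → ℝ → ℝ) : Prop :=
  Measurable (fun p : E N × E N × ℝ => K p.1 p.2.1 p.2.2) ∧
  (∀ x y t, K x y t = K y x t) ∧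
  ∀ x y : E N, x ≠ y → ∀ t ∈ Set.Ioo 0 T,
    Λ⁻¹ * ‖x - y‖ ^ (-((N : ℝ) + 2 * s)) ≤ K x y t ∧
      K x y t ≤ Λ * ‖x - y‖ ^ (-((N : ℝ) + 2 * s))

/-- `u` is a (bounded, measurable, smooth in `Ω × (0,T)`) weak supersolution of
`∂ₜ u + 𝓛 u = Δ u` in `Ω × (0,T)`. -/
def IsWeakSupersolution (N : ℕ) (T : ℝ) (K : E N → E N → ℝ → ℝ)
    (Ω : Set (E N)) (u : E N → ℝ → ℝ) : Prop :=
  Measurable (fun p : E N × ℝ => u p.1 p.2) ∧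
  (∃ M : ℝ, ∀ x t, t ∈ Set.Ioo 0 T → |u x t| ≤ M) ∧
  ContDiffOn ℝ (⊤ : ℕ∞) (fun p : E N × ℝ => u p.1 p.2) (Ω ×ˢ Set.Ioo 0 T) ∧
  ∀ φ : E N → ℝ → ℝ,
    ContDiff ℝ (⊤ : ℕ∞) (fun p : E N × ℝ => φ p.1 p.2) →
    HasCompactSupport (fun p : E N × ℝ => φ p.1 p.2) →
    tsupport (fun p : E N × ℝ => φ p.1 p.2) ⊆ Ω ×ˢ Set.Ioo 0 T →
    (∀ x t, 0 ≤ φ x t) →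
    0 ≤ -(∫ t in Set.Ioo 0 T, ∫ x in Ω, u x t * deriv (fun τ => φ x τ) t) +
        (∫ t in Set.Ioo 0 T, ∫ x in Ω,
          ⟪gradient (fun y => u y t) x, gradient (fun y => φ y t) x⟫) +
        ∫ t in Set.Ioo 0 T, ∫ x : E N, ∫ y : E N,
          (u x t - u y t) * (φ x t - φ y t) * K x y t

/-- The negative part `u₋ = max(-u, 0)`. -/
def uminus (N : ℕ) (u : E N → ℝ → ℝ) : E N → ℝ → ℝ := fun x t => max (-(u x t)) 0

/-- The parabolic tail `Tail_∞(w; x₀, ρ, t₁, t₂)`. -/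
def tailInfty (N : ℕ) (s : ℝ) (w : E N → ℝ → ℝ) (x₀ : E N) (ρ t₁ t₂ : ℝ) : ℝ :=
  ρ ^ 2 * essSup
      (fun t => ∫ y in (Metric.ball x₀ ρ)ᶜ, |w y t| * ‖y - x₀‖ ^ (-((N : ℝ) + 2 * s)))
      (volume.restrict (Set.Ioo t₁ t₂))

lemma ofReal_integral_le' {α : Type*} [MeasurableSpace α] (μ : Measure α) (f : α → ℝ) :
    ENNReal.ofReal (∫ x, f x ∂μ) ≤ ∫⁻ x, ENNReal.ofReal (f x) ∂μ := by
  by_cases hf : Integrable f μ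
  · rw [integral_eq_lintegral_pos_part_sub_lintegral_neg_part hf]
    refine le_trans (ENNReal.ofReal_le_ofReal (sub_le_self _ ENNReal.toReal_nonneg)) ?_
    exact ENNReal.ofReal_toReal_le
  · rw [integral_undef hf]; simp

lemma lintegral_affine (N : ℕ) (f : E N → ℝ≥0∞) (hf : Measurable f) (a : ℝ) (ha : 0 < a) (b : E N) :
    ∫⁻ x, f (a • x + b) = ENNReal.ofReal ((a ^ N)⁻¹) * ∫⁻ x, f x := by
  have h1 : ∫⁻ x, f x ∂(Measure.map (a • ·) (volume : Measure (E N))) =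
      ∫⁻ x, f (a • x) := lintegral_map hf (measurable_const_smul a)
  rw [← lintegral_add_right_eq_self f b] 
  have h2 := lintegral_map (μ := (volume : Measure (E N))) (f := fun x => f (x + b)) (by fun_prop)
    (measurable_const_smul a)
  rw [← h2, Measure.map_addHaar_smul _ ha.ne', lintegral_smul_measure]
  simp [abs_of_pos (pow_pos ha N)]

/-- model kernel -/
def mker (N : ℕ) (s C₀ : ℝ) (z : E N) : ℝ :=
  min (C₀ ^ 2 * ‖z‖ ^ 2) 1 * ‖z‖ ^ (-((N : ℝ) + 2 * s))

lemma mker_nonneg (N : ℕ) (s C₀ : ℝ) (z : E N) : 0 ≤ mker N s C₀ z := by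
  unfold mker; positivity

lemma mker_meas (N : ℕ) (s C₀ : ℝ) : Measurable (mker N s C₀) := by
  unfold mker; fun_prop

lemma mker_integrable (N : ℕ) (hN : 2 ≤ N) (s C₀ : ℝ) (hs : s ∈ Set.Ioo (0 : ℝ) 1) :
    Integrable (mker N s C₀) := by
  haveI : Nonempty (Fin N) := ⟨⟨0, by omega⟩⟩
  haveI : Nontrivial (E N) := inferInstance
  have := integrable_fun_norm_addHaar (volume : Measure (E N))
    (f := fun ρ : ℝ => min (C₀ ^ 2 * ρ ^ 2) 1 * ρ ^ (-((N : ℝ) + 2 * s)))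
  refine this.2 ?_
  have hd : Module.finrank ℝ (E N) = N := by simp
  rw [hd, ← Ioc_union_Ioi_eq_Ioi (zero_le_one : (0:ℝ) ≤ 1)]
  have hmeas : Measurable (fun y : ℝ => y ^ (N - 1) • (min (C₀ ^ 2 * y ^ 2) 1 * y ^ (-((N : ℝ) + 2 * s)))) := by
    fun_prop
  have hpow : ∀ y : ℝ, 0 < y → y ^ (N - 1) = y ^ ((N:ℝ) - 1) := by
    intro y hy
    rw [← Real.rpow_natCast]; congr 1
    rw [Nat.cast_sub (by omega)]; simp
  refine IntegrableOn.union ?_ ?_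
  · have h1 : IntegrableOn (fun y : ℝ => C₀ ^ 2 * y ^ (1 - 2 * s)) (Ioc 0 1) := by
      refine Integrable.const_mul ?_ _
      have := intervalIntegral.intervalIntegrable_rpow' (a := 0) (b := 1) (r := 1 - 2 * s) (by linarith [hs.2])
      rwa [intervalIntegrable_iff_integrableOn_Ioc_of_le zero_le_one] at this
    refine Integrable.mono' h1 hmeas.aestronglyMeasurable ?_
    refine (ae_restrict_iff' measurableSet_Ioc).2 (.of_forall fun y hy => ?_)
    have hy0 := hy.1
    rw [Real.norm_of_nonneg (by positivity), smul_eq_mul]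
    calc y ^ (N - 1) * (min (C₀ ^ 2 * y ^ 2) 1 * y ^ (-((N : ℝ) + 2 * s)))
        ≤ y ^ (N - 1) * ((C₀ ^ 2 * y ^ 2) * y ^ (-((N : ℝ) + 2 * s))) := by
          gcongr; exact min_le_left _ _
      _ = C₀ ^ 2 * y ^ (1 - 2 * s) := by
          rw [hpow y hy0, ← Real.rpow_natCast y 2]
          rw [show y ^ ((N:ℝ) - 1) * (C₀ ^ 2 * y ^ ((2:ℕ):ℝ) * y ^ (-((N : ℝ) + 2 * s))) =
            C₀ ^ 2 * (y ^ ((N:ℝ) - 1) * y ^ ((2:ℕ):ℝ) * y ^ (-((N : ℝ) + 2 * s))) by ring,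
            ← Real.rpow_add hy0, ← Real.rpow_add hy0]
          congr 2; push_cast; ring
  · have h1 : IntegrableOn (fun y : ℝ => y ^ (-1 - 2 * s)) (Ioi 1) :=
      integrableOn_Ioi_rpow_of_lt (by linarith [hs.1]) one_pos
    refine Integrable.mono' h1 hmeas.aestronglyMeasurable ?_
    refine (ae_restrict_iff' measurableSet_Ioi).2 (.of_forall fun y hy => ?_)
    have hy0 : 0 < y := lt_trans one_pos hy
    rw [Real.norm_of_nonneg (by positivity), smul_eq_mul]
    calc y ^ (N - 1) * (min (C₀ ^ 2 * y ^ 2) 1 * y ^ (-((N : ℝ) + 2 * s)))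
        ≤ y ^ (N - 1) * (1 * y ^ (-((N : ℝ) + 2 * s))) := by
          gcongr; exact min_le_right _ _
      _ = y ^ (-1 - 2 * s) := by
          rw [hpow y hy0, one_mul, ← Real.rpow_add hy0]
          congr 1; ring

lemma mker_scale (N : ℕ) (s C₀ r : ℝ) (hr : 0 < r) (z : E N) :
    min ((C₀ / r * ‖z‖) ^ 2) 1 * ‖z‖ ^ (-((N : ℝ) + 2 * s)) =
      r ^ (-((N : ℝ) + 2 * s)) * mker N s C₀ (r⁻¹ • z) := by
  unfold mker
  rw [norm_smul, Real.norm_of_nonneg (by positivity), Real.mul_rpow (by positivity) (by positivity),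
    Real.inv_rpow hr.le]
  have : r ^ (-((N : ℝ) + 2 * s)) ≠ 0 := (Real.rpow_pos_of_pos hr _).ne'
  rw [show (C₀ / r * ‖z‖) ^ 2 = C₀ ^ 2 * (r⁻¹ * ‖z‖) ^ 2 by field_simp]
  field_simp

lemma mker_lint (N : ℕ) (hN : 2 ≤ N) (s C₀ : ℝ) (hs : s ∈ Set.Ioo (0 : ℝ) 1) :
    ∃ C : ℝ, 0 ≤ C ∧ ∀ r : ℝ, 0 < r → r ≤ 1 → ∀ b : E N,
      ∫⁻ z : E N, ENNReal.ofReal (min ((C₀ / r * ‖z - b‖) ^ 2) 1 * ‖z - b‖ ^ (-((N : ℝ) + 2 * s)))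
        ≤ ENNReal.ofReal (C / r ^ 2) := by
  refine ⟨∫ z, mker N s C₀ z, integral_nonneg (mker_nonneg N s C₀), fun r hr hr1 b => ?_⟩
  simp_rw [mker_scale N s C₀ r hr]
  have hm := mker_meas N s C₀
  have hc : 0 ≤ r ^ (-((N : ℝ) + 2 * s)) := by positivity
  simp_rw [ENNReal.ofReal_mul hc]
  rw [lintegral_const_mul _ (by fun_prop)]
  have h2 := lintegral_affine N (fun z => ENNReal.ofReal (mker N s C₀ z)) (by fun_prop) r⁻¹
    (by positivity) (-(r⁻¹ • b))
  have h3 : ∀ z : E N, r⁻¹ • (z - b) = r⁻¹ • z + -(r⁻¹ • b) := fun z => by rw [smul_sub]; abel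
  simp_rw [h3]
  rw [h2, ← ofReal_integral_eq_lintegral_ofReal (mker_integrable N hN s C₀ hs)
    (.of_forall (mker_nonneg N s C₀)), ← ENNReal.ofReal_mul (by positivity),
    ← ENNReal.ofReal_mul (by positivity)]
  apply ENNReal.ofReal_le_ofReal
  have h4 : r ^ (-((N : ℝ) + 2 * s)) * ((r⁻¹ ^ N)⁻¹) ≤ 1 / r ^ 2 := by
    rw [inv_pow, inv_inv, ← Real.rpow_natCast r N, ← Real.rpow_add hr, one_div,
      ← Real.rpow_natCast r 2, ← Real.rpow_neg hr.le]
    apply Real.rpow_le_rpow_of_exponent_ge hr hr1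
    push_cast; linarith [hs.2]
  have h5 := mul_le_mul_of_nonneg_right h4 (integral_nonneg (mker_nonneg N s C₀) : 0 ≤ ∫ z, mker N s C₀ z)
  calc _ = _ := by rw [mul_assoc]
    _ ≤ _ := h5
    _ = _ := by ring

lemma ball_vol (N : ℕ) (hN : 2 ≤ N) (x : E N) (r : ℝ) (hr : 0 < r) :
    volume (ball x r) = ENNReal.ofReal (r ^ N * (volume : Measure (E N)).real (ball 0 1)) := by
  haveI : Nonempty (Fin N) := ⟨⟨0, by omega⟩⟩
  rw [Measure.addHaar_ball _ _ hr.le, ENNReal.ofReal_mul (by positivity), Measure.real,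
    ENNReal.ofReal_toReal measure_ball_lt_top.ne]
  simp

lemma ball_unit_pos (N : ℕ) : 0 < (volume : Measure (E N)).real (ball 0 1) :=
  ENNReal.toReal_pos (measure_ball_pos _ _ one_pos).ne' measure_ball_lt_top.ne

lemma alg_core (a b p q : ℝ) (ha : 0 < a) (hb : 0 < b) :
    (a - b) * (p ^ 2 / a - q ^ 2 / b) ≤ (p - q) ^ 2 := by
  have : (p - q) ^ 2 - (a - b) * (p ^ 2 / a - q ^ 2 / b) = (b * p - a * q) ^ 2 / (a * b) := by
    field_simp; ring
  have h2 : 0 ≤ (b * p - a * q) ^ 2 / (a * b) := by positivity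
  linarith

/-- truncated negative part outside of the ball -/
def bout (N : ℕ) (s : ℝ) (x₀ : E N) (R : ℝ) (U : E N → ℝ) : E N → ℝ :=
  (ball x₀ R)ᶜ.indicator fun y => max (-U y) 0 * ‖y - x₀‖ ^ (-((N : ℝ) + 2 * s))

def aker (N : ℕ) (s C₀ r : ℝ) (x y : E N) : ℝ :=
  min ((C₀ / r * ‖x - y‖) ^ 2) 1 * ‖x - y‖ ^ (-((N : ℝ) + 2 * s))

lemma bout_nonneg (N : ℕ) (s : ℝ) (x₀ : E N) (R : ℝ) (U : E N → ℝ) (y : E N) :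
    0 ≤ bout N s x₀ R U y := by
  unfold bout
  apply indicator_nonneg
  intro y _; positivity

lemma aker_nonneg (N : ℕ) (s C₀ r : ℝ) (x y : E N) : 0 ≤ aker N s C₀ r x y := by
  unfold aker; positivity

lemma aker_symm (N : ℕ) (s C₀ r : ℝ) (x y : E N) : aker N s C₀ r x y = aker N s C₀ r y x := by
  unfold aker; rw [norm_sub_rev]

lemma ptw_core (N : ℕ) (s Λ C₀ : ℝ) (hs : s ∈ Set.Ioo (0 : ℝ) 1) (hΛ : 1 ≤ Λ)
    (x₀ : E N) (R r l e : ℝ) (ψ U : E N → ℝ) (hr : 0 < r) (hR : r < R / 2) (hl : 0 < l) (he : 0 ≤ e)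
    (hψ0 : ∀ x, 0 ≤ ψ x) (hψ1 : ∀ x, ψ x ≤ 1) (hψs : ∀ x, x ∉ ball x₀ (3 * r / 2) → ψ x = 0)
    (hlip : ∀ x y, |ψ x - ψ y| ≤ C₀ / r * ‖x - y‖) (hU : ∀ x ∈ ball x₀ R, 0 ≤ U x)
    (x y : E N) (hx : x ∈ ball x₀ (3 * r / 2)) (κ : ℝ) (hκ : 0 ≤ κ)
    (hκ2 : κ ≤ Λ * ‖x - y‖ ^ (-((N : ℝ) + 2 * s))) :
    (U x - U y) * (e * ψ x ^ 2 / (U x + l) - e * ψ y ^ 2 / (U y + l)) * κ ≤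
      e * Λ * (aker N s C₀ r x y + 4 ^ ((N : ℝ) + 2 * s) / l * bout N s x₀ R U y) := by
  have hxR : x ∈ ball x₀ R := ball_subset_ball (by linarith) hx
  have ha : 0 < U x + l := by linarith [hU x hxR]
  have hpq : (ψ x - ψ y) ^ 2 ≤ min ((C₀ / r * ‖x - y‖) ^ 2) 1 := by
    apply le_min
    · exact sq_le_sq' (by linarith [(abs_le.1 (hlip x y)).1]) (abs_le.1 (hlip x y)).2
    · have := hψ0 x; have := hψ0 y; have := hψ1 x; have := hψ1 y
      nlinarith
  have hm : (ψ x - ψ y) ^ 2 * κ ≤ Λ * aker N s C₀ r x y := by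
    unfold aker
    calc (ψ x - ψ y) ^ 2 * κ ≤ min ((C₀ / r * ‖x - y‖) ^ 2) 1 * (Λ * ‖x - y‖ ^ (-((N : ℝ) + 2 * s))) :=
          mul_le_mul hpq hκ2 hκ (by positivity)
      _ = _ := by ring
  by_cases hy : y ∈ ball x₀ R
  · have hb : 0 < U y + l := by linarith [hU y hy]
    have h1 := alg_core (U x + l) (U y + l) (ψ x) (ψ y) ha hb
    have hb0 : bout N s x₀ R U y = 0 := by unfold bout; simp [hy]
    rw [hb0, mul_zero, add_zero]
    calc _ = e * (((U x + l) - (U y + l)) * (ψ x ^ 2 / (U x + l) - ψ y ^ 2 / (U y + l))) * κ := by ring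
      _ ≤ e * (ψ x - ψ y) ^ 2 * κ := by gcongr
      _ = e * ((ψ x - ψ y) ^ 2 * κ) := by ring
      _ ≤ e * (Λ * aker N s C₀ r x y) := by gcongr
      _ = _ := by ring
  · have hψy : ψ y = 0 := hψs y (fun h => hy (ball_subset_ball (by linarith) h))
    have hb0 : bout N s x₀ R U y = max (-U y) 0 * ‖y - x₀‖ ^ (-((N : ℝ) + 2 * s)) := by
      unfold bout; rw [indicator_of_mem hy]
    rw [hψy, sub_zero] at hm
    rw [hψy, hb0]
    set m := max (-U y) 0 with hmd
    have hm0 : 0 ≤ m := le_max_right _ _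
    have hm1 : -U y ≤ m := le_max_left _ _
    have h2 : (U x - U y) / (U x + l) ≤ 1 + m / l := by
      have h3 : (U x - U y) / (U x + l) ≤ ((U x + l) + m) / (U x + l) := by gcongr; linarith
      rw [add_div, div_self ha.ne'] at h3
      refine h3.trans ?_
      gcongr; linarith [hU x hxR]
    have hR0 : 0 < R := by linarith
    have hyn : R ≤ ‖y - x₀‖ := by
      rw [mem_ball, dist_eq_norm] at hy; linarith
    have hxn : ‖x - x₀‖ < 3 * r / 2 := by rwa [mem_ball, dist_eq_norm] at hx
    have h4 : ‖y - x₀‖ / 4 ≤ ‖x - y‖ := by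
      have := norm_sub_le_norm_sub_add_norm_sub y x x₀
      rw [norm_sub_rev y x] at this
      linarith
    have hκ3 : κ ≤ Λ * (4 ^ ((N : ℝ) + 2 * s) * ‖y - x₀‖ ^ (-((N : ℝ) + 2 * s))) := by
      refine hκ2.trans ?_
      gcongr
      calc ‖x - y‖ ^ (-((N : ℝ) + 2 * s)) ≤ (‖y - x₀‖ / 4) ^ (-((N : ℝ) + 2 * s)) := by
            apply Real.rpow_le_rpow_of_nonpos (by linarith) h4
            have := hs.1
            have : (0:ℝ) ≤ N := by positivity
            linarith
        _ = _ := by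
            rw [Real.div_rpow (by linarith) (by norm_num), Real.rpow_neg (by norm_num : (0:ℝ) ≤ 4)]
            field_simp
    have hp1 : ψ x ^ 2 ≤ 1 := pow_le_one₀ (hψ0 x) (hψ1 x)
    calc _ = e * ψ x ^ 2 * ((U x - U y) / (U x + l)) * κ := by ring
      _ ≤ e * ψ x ^ 2 * (1 + m / l) * κ := by gcongr
      _ = e * (ψ x ^ 2 * κ) + e * (m / l) * (ψ x ^ 2 * κ) := by ring
      _ ≤ e * (Λ * aker N s C₀ r x y) + e * (m / l) *
            (1 * (Λ * (4 ^ ((N : ℝ) + 2 * s) * ‖y - x₀‖ ^ (-((N : ℝ) + 2 * s))))) := by gcongr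
      _ = _ := by ring

lemma nonlocal_bound (N : ℕ) (hN : 2 ≤ N) (s Λ C₀ : ℝ) (hs : s ∈ Set.Ioo (0 : ℝ) 1) (hΛ : 1 ≤ Λ) :
    ∃ C : ℝ, 0 ≤ C ∧ ∀ (x₀ : E N) (R r l e S : ℝ) (ψ U : E N → ℝ) (k : E N → E N → ℝ),
      0 < r → r ≤ 1 → r < R / 2 → 0 < l → 0 ≤ e → Measurable U →
      (∀ x, 0 ≤ ψ x) → (∀ x, ψ x ≤ 1) → (∀ x, x ∉ ball x₀ (3 * r / 2) → ψ x = 0) →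
      (∀ x y, |ψ x - ψ y| ≤ C₀ / r * ‖x - y‖) → (∀ x ∈ ball x₀ R, 0 ≤ U x) →
      (∫⁻ y in (ball x₀ R)ᶜ, ENNReal.ofReal (max (-U y) 0 * ‖y - x₀‖ ^ (-((N : ℝ) + 2 * s)))
        ≤ ENNReal.ofReal S) → 0 ≤ S → r ^ 2 * S ≤ l →
      (∀ x y, x ≠ y → 0 ≤ k x y ∧ k x y ≤ Λ * ‖x - y‖ ^ (-((N : ℝ) + 2 * s))) →
      ∫ x, ∫ y, (U x - U y) * (e * ψ x ^ 2 / (U x + l) - e * ψ y ^ 2 / (U y + l)) * k x y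
        ≤ e * (C * r ^ N / r ^ 2) := by
  obtain ⟨Cm, hCm0, hCm⟩ := mker_lint N hN s C₀ hs
  have hω := ball_unit_pos N
  set ω := (volume : Measure (E N)).real (ball 0 1) with hωd
  refine ⟨2 * Λ * (Cm + 4 ^ ((N : ℝ) + 2 * s)) * ((3 / 2) ^ N * ω), by positivity, ?_⟩
  intro x₀ R r l e S ψ U k hr hr1 hR hl he hUm hψ0 hψ1 hψs hlip hU hS hS0 hSl hk
  set B := ball x₀ (3 * r / 2) with hB
  set q : E N → E N → ℝ≥0∞ := fun x y => B.indicator (fun x => ENNReal.ofReal (aker N s C₀ r x y) + ENNReal.ofReal (4 ^ ((N : ℝ) + 2 * s) / l) *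
    ENNReal.ofReal (bout N s x₀ R U y)) x with hq
  have hbm : Measurable (bout N s x₀ R U) := by
    unfold bout
    refine Measurable.indicator ?_ measurableSet_ball.compl
    fun_prop
  have ham : Measurable (fun p : E N × E N => aker N s C₀ r p.1 p.2) := by
    unfold aker; fun_prop
  have hqm : Measurable (Function.uncurry q) := by
    have : Function.uncurry q = (B ×ˢ univ).indicator (fun p : E N × E N => ENNReal.ofReal (aker N s C₀ r p.1 p.2) + ENNReal.ofReal (4 ^ ((N : ℝ) + 2 * s) / l) *
      ENNReal.ofReal (bout N s x₀ R U p.2)) := by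
      ext ⟨x, y⟩
      by_cases hx : x ∈ B <;> simp [q, hx, Function.uncurry, indicator]
    rw [this]
    refine Measurable.indicator ?_ (measurableSet_ball.prod MeasurableSet.univ)
    fun_prop
  have hq1 : ∀ x y, x ∈ B → ∀ κ : ℝ, 0 ≤ κ → κ ≤ Λ * ‖x - y‖ ^ (-((N : ℝ) + 2 * s)) →
      ENNReal.ofReal ((U x - U y) * (e * ψ x ^ 2 / (U x + l) - e * ψ y ^ 2 / (U y + l)) * κ) ≤
        ENNReal.ofReal (e * Λ) * q x y := by
    intro x y hx κ h1 h2
    have := ptw_core N s Λ C₀ hs hΛ x₀ R r l e ψ U hr hR hl he hψ0 hψ1 hψs hlip hU x y hx κ h1 h2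
    refine (ENNReal.ofReal_le_ofReal this).trans ?_
    rw [ENNReal.ofReal_mul (by positivity), ENNReal.ofReal_add (aker_nonneg ..)
      (mul_nonneg (by positivity) (bout_nonneg ..)), ENNReal.ofReal_mul (p := 4 ^ ((N : ℝ) + 2 * s) / l) (by positivity)]
    simp [q, hx]
  have hq2 : ∀ x y, ENNReal.ofReal ((U x - U y) * (e * ψ x ^ 2 / (U x + l) - e * ψ y ^ 2 / (U y + l)) * k x y) ≤
        ENNReal.ofReal (e * Λ) * (q x y + q y x) := by
    intro x y
    by_cases hxy : x = y
    · subst hxy; simp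
    by_cases hx : x ∈ B
    · refine (hq1 x y hx _ (hk x y hxy).1 (hk x y hxy).2).trans ?_
      gcongr; exact le_self_add
    by_cases hy : y ∈ B
    · have := hq1 y x hy (k x y) (hk x y hxy).1 (by rw [norm_sub_rev]; exact (hk x y hxy).2)
      rw [show (U y - U x) * (e * ψ y ^ 2 / (U y + l) - e * ψ x ^ 2 / (U x + l)) * k x y =
        (U x - U y) * (e * ψ x ^ 2 / (U x + l) - e * ψ y ^ 2 / (U y + l)) * k x y by ring] at this
      refine this.trans ?_
      gcongr; exact le_add_self
    · simp [hψs x hx, hψs y hy]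
  have hI : ∀ x, ∫⁻ y, q x y ≤ B.indicator (fun _ => ENNReal.ofReal ((Cm + 4 ^ ((N : ℝ) + 2 * s)) / r ^ 2)) x := by
    intro x
    by_cases hx : x ∈ B
    · simp only [q, indicator_of_mem hx]
      rw [lintegral_add_right _ (by fun_prop), lintegral_const_mul _ (by fun_prop), add_div,
        ENNReal.ofReal_add (by positivity) (by positivity)]
      gcongr
      · have := hCm r hr hr1 x
        refine le_trans (le_of_eq ?_) this
        congr 1; ext y; rw [aker_symm]; rfl
      · have : ∫⁻ y, ENNReal.ofReal (bout N s x₀ R U y) ≤ ENNReal.ofReal S := by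
          refine le_trans (le_of_eq ?_) hS
          rw [← lintegral_indicator measurableSet_ball.compl]
          congr 1; ext y
          by_cases hy : y ∈ ball x₀ R
          · simp [bout, hy]
          · unfold bout
            rw [indicator_of_mem hy, indicator_of_mem hy]
        refine (mul_le_mul_right this _).trans ?_
        rw [← ENNReal.ofReal_mul (by positivity)]
        apply ENNReal.ofReal_le_ofReal
        rw [div_mul_eq_mul_div, div_le_div_iff₀ hl (by positivity)]
        have h4 : (0:ℝ) ≤ 4 ^ ((N : ℝ) + 2 * s) := by positivity
        nlinarith
    · simp [q, hx]
  have hJ : ∫⁻ x, ∫⁻ y, q x y ≤ ENNReal.ofReal ((Cm + 4 ^ ((N : ℝ) + 2 * s)) / r ^ 2 * ((3 * r / 2) ^ N * ω)) := by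
    refine (lintegral_mono hI).trans ?_
    rw [lintegral_indicator measurableSet_ball, setLIntegral_const, ball_vol N hN _ _ (by positivity),
      ← ENNReal.ofReal_mul (by positivity)]
  have hJ2 : ∫⁻ x, ∫⁻ y, q y x = ∫⁻ x, ∫⁻ y, q x y :=
    (lintegral_lintegral_swap hqm.aemeasurable).symm
  have hfin : ENNReal.ofReal (∫ x, ∫ y, (U x - U y) * (e * ψ x ^ 2 / (U x + l) - e * ψ y ^ 2 / (U y + l)) * k x y)
      ≤ ENNReal.ofReal (e * Λ * (2 * ((Cm + 4 ^ ((N : ℝ) + 2 * s)) / r ^ 2 * ((3 * r / 2) ^ N * ω)))) := by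
    refine (ofReal_integral_le' _ _).trans ?_
    refine (lintegral_mono fun x => ofReal_integral_le' _ _).trans ?_
    refine (lintegral_mono fun x => lintegral_mono fun y => hq2 x y).trans ?_
    have hqm1 : ∀ x, Measurable (q x) := fun x => hqm.of_uncurry_left
    have hqm2 : ∀ x, Measurable (fun y => q y x) := fun x => hqm.of_uncurry_right
    have e1 : ∀ x, ∫⁻ y, ENNReal.ofReal (e * Λ) * (q x y + q y x) =
        ENNReal.ofReal (e * Λ) * ((∫⁻ y, q x y) + (∫⁻ y, q y x)) := by
      intro x
      rw [lintegral_const_mul (f := fun y => q x y + q y x) _ ((hqm1 x).add (hqm2 x)), lintegral_add_left (hqm1 x)]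
    simp_rw [e1]
    have m1 : Measurable fun x => ∫⁻ y, q x y := hqm.lintegral_prod_right'
    have m2 : Measurable fun x => ∫⁻ y, q y x := hqm.lintegral_prod_left'
    rw [lintegral_const_mul (f := fun x => (∫⁻ y, q x y) + (∫⁻ y, q y x)) _ (m1.add m2), lintegral_add_left m1, hJ2, ENNReal.ofReal_mul (p := e * Λ) (by positivity)]
    gcongr
    rw [← two_mul, ENNReal.ofReal_mul (by norm_num)]
    gcongr
    simp
  have h0 : 0 ≤ e * Λ * (2 * ((Cm + 4 ^ ((N : ℝ) + 2 * s)) / r ^ 2 * ((3 * r / 2) ^ N * ω))) := by positivity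
  refine ((ENNReal.ofReal_le_ofReal_iff h0).1 hfin).trans (le_of_eq ?_)
  rw [show 3 * r / 2 = 3 / 2 * r by ring, mul_pow]
  ring

lemma cont_mul_supp {X : Type*} [TopologicalSpace X] (ψ f : X → ℝ) (V : Set X) (hV : IsOpen V)
    (hψ : Continuous ψ) (hs : tsupport ψ ⊆ V) (hf : ContinuousOn f V) :
    Continuous fun x => ψ x * f x := by
  rw [continuous_iff_continuousAt]
  intro x
  by_cases hx : x ∈ tsupport ψ
  · exact hψ.continuousAt.mul (hf.continuousAt (hV.mem_nhds (hs hx)))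
  · have h1 : ψ =ᶠ[nhds x] 0 := notMem_tsupport_iff_eventuallyEq.1 hx
    have h2 : (fun x => ψ x * f x) =ᶠ[nhds x] fun _ => 0 := by
      filter_upwards [h1] with y hy; simp [hy]
    exact (continuousAt_congr h2).2 continuousAt_const

lemma contDiff_mul_supp {X : Type*} [NormedAddCommGroup X] [NormedSpace ℝ X] {n : WithTop ℕ∞}
    (ψ f : X → ℝ) (V : Set X) (hV : IsOpen V)
    (hψ : ContDiff ℝ n ψ) (hs : tsupport ψ ⊆ V) (hf : ContDiffOn ℝ n f V) :
    ContDiff ℝ n fun x => ψ x * f x := by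
  rw [contDiff_iff_contDiffAt]
  intro x
  by_cases hx : x ∈ tsupport ψ
  · exact hψ.contDiffAt.mul (hf.contDiffAt (hV.mem_nhds (hs hx)))
  · have h1 : ψ =ᶠ[nhds x] 0 := notMem_tsupport_iff_eventuallyEq.1 hx
    have h2 : (fun x => ψ x * f x) =ᶠ[nhds x] fun _ => 0 := by
      filter_upwards [h1] with y hy; simp [hy]
    exact contDiffAt_const.congr_of_eventuallyEq h2

lemma tsupport_sq_sub {X : Type*} [TopologicalSpace X] (ψ : X → ℝ) :
    tsupport (fun x => ψ x ^ 2) ⊆ tsupport ψ := by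
  refine closure_mono fun x hx => ?_
  simp only [Function.mem_support] at *
  intro h; apply hx; simp [h]

lemma hcs_mul {X : Type*} [TopologicalSpace X] (ψ f : X → ℝ) (h : HasCompactSupport ψ) :
    HasCompactSupport (fun x => ψ x * f x) := h.mul_right

lemma int_lin3 (N : ℕ) (f g h : E N → ℝ) (hf : Integrable f) (hg : Integrable g) (hh : Integrable h)
    (a b c : ℝ) : ∫ x, (a * f x - b * g x + c * h x) =
      a * (∫ x, f x) - b * (∫ x, g x) + c * ∫ x, h x := by
  have h1 : Integrable fun x => a * f x := hf.const_mul a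
  have h2 : Integrable fun x => b * g x := hg.const_mul b
  have h3 : Integrable fun x => c * h x := hh.const_mul c
  have h4 : Integrable fun x => a * f x - b * g x := h1.sub h2
  rw [integral_add h4 h3, integral_sub h1 h2, integral_const_mul, integral_const_mul,
    integral_const_mul]

lemma var_identity (N : ℕ) (ρ w : E N → ℝ) (h0 : Integrable ρ) (h1 : Integrable fun x => ρ x * w x)
    (h2 : Integrable fun x => ρ x * w x ^ 2) (hI : 0 < ∫ x, ρ x) :
    2 * (∫ x, ρ x) * ∫ x, ρ x * (w x - (∫ x, ρ x * w x) / ∫ x, ρ x) ^ 2 =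
      ∫ x, ∫ y, ρ x * ρ y * (w x - w y) ^ 2 := by
  set I0 := ∫ x, ρ x
  set I1 := ∫ x, ρ x * w x
  set I2 := ∫ x, ρ x * w x ^ 2
  have e1 : ∀ c : ℝ, ∫ x, ρ x * (w x - c) ^ 2 = I2 - 2 * c * I1 + c ^ 2 * I0 := by
    intro c
    have : ∀ x, ρ x * (w x - c) ^ 2 = 1 * (ρ x * w x ^ 2) - 2 * c * (ρ x * w x) + c ^ 2 * ρ x := by
      intro x; ring
    simp_rw [this]
    rw [int_lin3 N _ _ _ h2 h1 h0, one_mul]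
  have e2 : ∀ x, ∫ y, ρ x * ρ y * (w x - w y) ^ 2 = ρ x * (I2 - 2 * w x * I1 + w x ^ 2 * I0) := by
    intro x
    rw [← e1, ← integral_const_mul]
    congr 1; ext y; ring
  simp_rw [e2]
  have e3 : ∀ x, ρ x * (I2 - 2 * w x * I1 + w x ^ 2 * I0) =
      I2 * ρ x - 2 * I1 * (ρ x * w x) + I0 * (ρ x * w x ^ 2) := by intro x; ring
  simp_rw [e3]
  rw [int_lin3 N _ _ _ h0 h1 h2, e1]
  change 2 * I0 * (I2 - 2 * (I1 / I0) * I1 + (I1 / I0) ^ 2 * I0) = I2 * I0 - 2 * I1 * I1 + I0 * I2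
  field_simp; ring

lemma seg_est (N : ℕ) (x₀ : E N) (r R : ℝ) (hr : 0 < r) (hR : 3 * r / 2 < R) (ψ w : E N → ℝ)
    (hψ0 : ∀ x, 0 ≤ ψ x) (hψ1 : ∀ x, ψ x ≤ 1)
    (hg : ∃ g : ℝ → ℝ, AntitoneOn g (Set.Ici 0) ∧ ∀ x, ψ x = g ‖x - x₀‖)
    (hw : ContDiffOn ℝ 1 w (ball x₀ R)) (G : E N → ℝ) (hG : G = fun x => ψ x * ‖fderiv ℝ w x‖)
    (hGc : Continuous G) (x y : E N) (hx : x ∈ ball x₀ (3 * r / 2)) (hy : y ∈ ball x₀ (3 * r / 2)) :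
    ψ x ^ 2 * ψ y ^ 2 * (w x - w y) ^ 2 ≤
      9 * r ^ 2 * ∫ τ in (0:ℝ)..1, (G (x + τ • (y - x))) ^ 2 := by
  have hseg : ∀ τ ∈ Icc (0:ℝ) 1, x + τ • (y - x) ∈ ball x₀ (3 * r / 2) := by
    intro τ hτ
    have := (convex_ball x₀ (3 * r / 2)).add_smul_sub_mem hx hy hτ
    simpa using this
  have hψz : ∀ τ ∈ Icc (0:ℝ) 1, ψ x * ψ y ≤ ψ (x + τ • (y - x)) := by
    intro τ hτ
    obtain ⟨g, hga, hgx⟩ := hg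
    have hz : ‖x + τ • (y - x) - x₀‖ ≤ max ‖x - x₀‖ ‖y - x₀‖ := by
      have e : x + τ • (y - x) - x₀ = (1 - τ) • (x - x₀) + τ • (y - x₀) := by module
      rw [e]
      refine (norm_add_le _ _).trans ?_
      rw [norm_smul, norm_smul, Real.norm_of_nonneg hτ.1, Real.norm_of_nonneg (by linarith [hτ.2])]
      have h1 := le_max_left ‖x - x₀‖ ‖y - x₀‖
      have h2 := le_max_right ‖x - x₀‖ ‖y - x₀‖
      nlinarith [hτ.1, hτ.2]
    rcases max_choice ‖x - x₀‖ ‖y - x₀‖ with h | h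
    · rw [h] at hz
      have := hga (norm_nonneg _) (norm_nonneg _) hz
      rw [← hgx, ← hgx] at this
      nlinarith [hψ0 x, hψ1 y, hψ0 y]
    · rw [h] at hz
      have := hga (norm_nonneg _) (norm_nonneg _) hz
      rw [← hgx, ← hgx] at this
      nlinarith [hψ0 x, hψ1 x, hψ0 y]
  have hline : Continuous fun τ : ℝ => x + τ • (y - x) := by fun_prop
  have hsubB : ball x₀ (3 * r / 2) ⊆ ball x₀ R := ball_subset_ball hR.le
  have hfd : ContinuousOn (fderiv ℝ w) (ball x₀ R) :=
    hw.continuousOn_fderiv_of_isOpen isOpen_ball le_rfl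
  have hder : ∀ τ ∈ Icc (0:ℝ) 1, HasDerivAt (fun τ : ℝ => w (x + τ • (y - x)))
      (fderiv ℝ w (x + τ • (y - x)) (y - x)) τ := by
    intro τ hτ
    have hd : DifferentiableAt ℝ w (x + τ • (y - x)) :=
      ((hw.differentiableOn one_ne_zero) _ (hsubB (hseg τ hτ))).differentiableAt
        (isOpen_ball.mem_nhds (hsubB (hseg τ hτ)))
    have hl : HasDerivAt (fun τ : ℝ => x + τ • (y - x)) (y - x) τ := by
      simpa using ((hasDerivAt_id τ).smul_const (y - x)).const_add x
    exact hd.hasFDerivAt.comp_hasDerivAt τ hl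
  have hcont : ContinuousOn (fun τ : ℝ => fderiv ℝ w (x + τ • (y - x)) (y - x)) (Icc 0 1) := by
    refine ContinuousOn.clm_apply ?_ continuousOn_const
    exact hfd.comp hline.continuousOn (fun τ hτ => hsubB (hseg τ hτ))
  have hftc : ∫ τ in (0:ℝ)..1, fderiv ℝ w (x + τ • (y - x)) (y - x) = w y - w x := by
    rw [intervalIntegral.integral_eq_sub_of_hasDerivAt (f := fun τ : ℝ => w (x + τ • (y - x)))]
    · simp
    · intro τ hτ; rw [uIcc_of_le zero_le_one] at hτ; exact hder τ hτ
    · apply ContinuousOn.intervalIntegrable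
      rwa [uIcc_of_le zero_le_one]
  have hxy : ‖y - x‖ ≤ 3 * r := by
    rw [mem_ball, dist_eq_norm] at hx hy
    have := norm_sub_le_norm_sub_add_norm_sub y x₀ x
    rw [norm_sub_rev x₀ x] at this
    linarith
  have hGl : Continuous fun τ : ℝ => G (x + τ • (y - x)) := hGc.comp hline
  set J := ∫ τ in (0:ℝ)..1, G (x + τ • (y - x)) with hJ
  have hJ0 : 0 ≤ J := by
    apply intervalIntegral.integral_nonneg zero_le_one
    intro τ _; rw [hG]; exact mul_nonneg (hψ0 _) (norm_nonneg _)
  have hkey : ψ x * ψ y * |w y - w x| ≤ 3 * r * J := by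
    have e1 : ψ x * ψ y * (w y - w x) = ∫ τ in (0:ℝ)..1, ψ x * ψ y * fderiv ℝ w (x + τ • (y - x)) (y - x) := by
      rw [intervalIntegral.integral_const_mul, hftc]
    rw [← abs_of_nonneg (mul_nonneg (hψ0 x) (hψ0 y)), ← abs_mul, e1, hJ, ← intervalIntegral.integral_const_mul,
      ← Real.norm_eq_abs]
    refine intervalIntegral.norm_integral_le_of_norm_le zero_le_one ?_ ?_
    · refine .of_forall fun τ hτ => ?_
      have hτ' : τ ∈ Icc (0:ℝ) 1 := ⟨hτ.1.le, hτ.2⟩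
      rw [norm_mul, Real.norm_of_nonneg (mul_nonneg (hψ0 x) (hψ0 y))]
      calc ψ x * ψ y * ‖fderiv ℝ w (x + τ • (y - x)) (y - x)‖
          ≤ ψ (x + τ • (y - x)) * (‖fderiv ℝ w (x + τ • (y - x))‖ * (3 * r)) := by
            apply mul_le_mul (hψz τ hτ') _ (norm_nonneg _) (hψ0 _)
            exact (ContinuousLinearMap.le_opNorm _ _).trans (by gcongr)
        _ = 3 * r * G (x + τ • (y - x)) := by rw [hG]; ring
    · exact (continuous_const.mul hGl).intervalIntegrable _ _
  have hJ2 : J ^ 2 ≤ ∫ τ in (0:ℝ)..1, (G (x + τ • (y - x))) ^ 2 := by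
    have h1 : 0 ≤ ∫ τ in (0:ℝ)..1, (G (x + τ • (y - x)) - J) ^ 2 :=
      intervalIntegral.integral_nonneg zero_le_one fun τ _ => sq_nonneg _
    have e : ∀ τ : ℝ, (G (x + τ • (y - x)) - J) ^ 2 = (G (x + τ • (y - x))) ^ 2 - 2 * J * G (x + τ • (y - x)) + J ^ 2 := by
      intro τ; ring
    simp_rw [e] at h1
    rw [intervalIntegral.integral_add (by apply Continuous.intervalIntegrable; fun_prop) (by simp),
      intervalIntegral.integral_sub (by apply Continuous.intervalIntegrable; fun_prop)
        (by apply Continuous.intervalIntegrable; fun_prop), intervalIntegral.integral_const_mul, ← hJ] at h1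
    simp at h1
    nlinarith
  have h3 : (ψ x * ψ y * |w y - w x|) ^ 2 ≤ (3 * r * J) ^ 2 :=
    pow_le_pow_left₀ (mul_nonneg (mul_nonneg (hψ0 x) (hψ0 y)) (abs_nonneg _)) hkey 2
  have h4 : (ψ x * ψ y * |w y - w x|) ^ 2 = ψ x ^ 2 * ψ y ^ 2 * (w x - w y) ^ 2 := by
    rw [mul_pow, sq_abs]; ring
  calc _ ≤ (3 * r * J) ^ 2 := by rw [← h4]; exact h3
    _ = 9 * r ^ 2 * J ^ 2 := by ring
    _ ≤ _ := by gcongr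

lemma avg_line (N : ℕ) (B : Set (E N)) (H : E N → ℝ≥0∞) (hH : Measurable H) :
    ∫⁻ x in B, ∫⁻ y in B, ∫⁻ τ in Ioc (0:ℝ) 1, H (x + τ • (y - x)) ≤
      volume B * (ENNReal.ofReal (2 ^ N) * ∫⁻ z, H z) := by
  have hsm : ∀ a : ℝ, 1 / 2 ≤ a → ENNReal.ofReal ((a ^ N)⁻¹) ≤ ENNReal.ofReal (2 ^ N) := by
    intro a ha
    apply ENNReal.ofReal_le_ofReal
    rw [← inv_pow]
    apply pow_le_pow_left₀ (by positivity)
    rw [inv_le_comm₀ (by linarith) (by norm_num)]; linarith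
  have hone : ∀ τ ∈ Ioc (0:ℝ) 1, ∫⁻ x in B, ∫⁻ y in B, H (x + τ • (y - x)) ≤
      volume B * (ENNReal.ofReal (2 ^ N) * ∫⁻ z, H z) := by
    intro τ hτ
    rcases le_total (1/2) τ with h | h
    · have : ∀ x, ∫⁻ y in B, H (x + τ • (y - x)) ≤ (ENNReal.ofReal (2 ^ N) * ∫⁻ z, H z) := by
        intro x
        refine (setLIntegral_le_lintegral _ _).trans ?_
        have e : ∀ y, x + τ • (y - x) = τ • y + (x - τ • x) := fun y => by module
        simp_rw [e]
        rw [lintegral_affine N H hH τ (by linarith)]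
        gcongr ?_ * _
        exact hsm τ h
      refine (lintegral_mono this).trans ?_
      rw [setLIntegral_const, mul_comm]
    · rw [lintegral_lintegral_swap (by fun_prop)]
      have : ∀ y, ∫⁻ x in B, H (x + τ • (y - x)) ≤ (ENNReal.ofReal (2 ^ N) * ∫⁻ z, H z) := by
        intro y
        refine (setLIntegral_le_lintegral _ _).trans ?_
        have e : ∀ x, x + τ • (y - x) = (1 - τ) • x + (τ • y) := fun x => by module
        simp_rw [e]
        rw [lintegral_affine N H hH (1 - τ) (by linarith)]
        gcongr ?_ * _
        exact hsm (1 - τ) (by linarith)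
      refine (lintegral_mono this).trans ?_
      rw [setLIntegral_const, mul_comm]
  have h1 : ∀ x, ∫⁻ y in B, ∫⁻ τ in Ioc (0:ℝ) 1, H (x + τ • (y - x)) =
      ∫⁻ τ in Ioc (0:ℝ) 1, ∫⁻ y in B, H (x + τ • (y - x)) := by
    intro x
    exact lintegral_lintegral_swap (by fun_prop)
  simp_rw [h1]
  have hm : Measurable (fun p : (E N × ℝ) × E N => H (p.1.1 + p.1.2 • (p.2 - p.1.1))) := by fun_prop
  have hm2 : Measurable (fun p : E N × ℝ => ∫⁻ y in B, H (p.1 + p.2 • (y - p.1))) :=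
    hm.lintegral_prod_right'
  rw [lintegral_lintegral_swap hm2.aemeasurable]
  refine (setLIntegral_mono' measurableSet_Ioc hone).trans ?_
  rw [setLIntegral_const]; simp

lemma poincare (N : ℕ) (hN : 2 ≤ N) (x₀ : E N) (r R : ℝ) (hr : 0 < r) (hR : 3 * r / 2 < R) (ψ w : E N → ℝ)
    (hψc : Continuous ψ) (hψk : HasCompactSupport ψ) (hψs : tsupport ψ ⊆ ball x₀ (3 * r / 2))
    (hψ0 : ∀ x, 0 ≤ ψ x) (hψ1 : ∀ x, ψ x ≤ 1)
    (hg : ∃ g : ℝ → ℝ, AntitoneOn g (Set.Ici 0) ∧ ∀ x, ψ x = g ‖x - x₀‖)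
    (hψr : r ^ N * (volume : Measure (E N)).real (ball 0 1) ≤ ∫ x, ψ x ^ 2)
    (hw : ContDiffOn ℝ 1 w (ball x₀ R)) :
    ∫ x, ψ x ^ 2 * (w x - (∫ x, ψ x ^ 2 * w x) / ∫ x, ψ x ^ 2) ^ 2 ≤
      9 * 3 ^ N / 2 * r ^ 2 * ∫ x, ψ x ^ 2 * ‖fderiv ℝ w x‖ ^ 2 := by
  have hω := ball_unit_pos N
  set ω := (volume : Measure (E N)).real (ball 0 1) with hωd
  have hsubB : ball x₀ (3 * r / 2) ⊆ ball x₀ R := ball_subset_ball hR.le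
  have hψsR := hψs.trans hsubB
  have hk2 : HasCompactSupport fun x => ψ x ^ 2 := hψk.of_isClosed_subset (isClosed_tsupport _) (tsupport_sq_sub ψ)
  have hs2 : tsupport (fun x => ψ x ^ 2) ⊆ ball x₀ R := (tsupport_sq_sub ψ).trans hψsR
  have hc2 : Continuous fun x => ψ x ^ 2 := by fun_prop
  have hwc := hw.continuousOn
  have h0 : Integrable fun x => ψ x ^ 2 := hc2.integrable_of_hasCompactSupport hk2
  have h1 : Integrable fun x => ψ x ^ 2 * w x :=
    (cont_mul_supp _ _ _ isOpen_ball hc2 hs2 hwc).integrable_of_hasCompactSupport hk2.mul_right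
  have h2 : Integrable fun x => ψ x ^ 2 * w x ^ 2 :=
    (cont_mul_supp _ _ _ isOpen_ball hc2 hs2 (hwc.pow 2)).integrable_of_hasCompactSupport hk2.mul_right
  have hI0 : 0 < ∫ x, ψ x ^ 2 := lt_of_lt_of_le (by positivity) hψr
  have hvar := var_identity N (fun x => ψ x ^ 2) w h0 h1 h2 hI0
  have hfd : ContinuousOn (fderiv ℝ w) (ball x₀ R) :=
    hw.continuousOn_fderiv_of_isOpen isOpen_ball le_rfl
  set G : E N → ℝ := fun x => ψ x * ‖fderiv ℝ w x‖ with hG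
  have hGc : Continuous G := cont_mul_supp _ _ _ isOpen_ball hψc hψsR hfd.norm
  have hGk : HasCompactSupport G := hψk.mul_right
  have hG2 : Integrable fun x => G x ^ 2 := by
    apply (hGc.pow 2).integrable_of_hasCompactSupport
    exact hGk.of_isClosed_subset (isClosed_tsupport _) (tsupport_sq_sub G)
  have hGe : ∫ x, ψ x ^ 2 * ‖fderiv ℝ w x‖ ^ 2 = ∫ x, G x ^ 2 := by
    congr 1; ext x; rw [hG]; ring
  set H : E N → ℝ≥0∞ := fun z => ENNReal.ofReal (G z ^ 2) with hH
  have hHm : Measurable H := by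
    have := hGc.measurable
    fun_prop
  have hHi : ∫⁻ z, H z = ENNReal.ofReal (∫ x, G x ^ 2) := by
    rw [ofReal_integral_eq_lintegral_ofReal hG2 (.of_forall fun x => sq_nonneg _)]
  set B := ball x₀ (3 * r / 2) with hB
  have hψz : ∀ x, x ∉ B → ψ x = 0 := fun x hx => image_eq_zero_of_notMem_tsupport fun h => hx (hψs h)
  have hpt : ∀ x y, ENNReal.ofReal (ψ x ^ 2 * ψ y ^ 2 * (w x - w y) ^ 2) ≤
      B.indicator (fun x => B.indicator (fun y => ENNReal.ofReal (9 * r ^ 2) *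
        ∫⁻ τ in Ioc (0:ℝ) 1, H (x + τ • (y - x))) y) x := by
    intro x y
    by_cases hx : x ∈ B
    · by_cases hy : y ∈ B
      · rw [indicator_of_mem hx, indicator_of_mem hy]
        refine (ENNReal.ofReal_le_ofReal (seg_est N x₀ r R hr hR ψ w hψ0 hψ1 hg hw G hG hGc x y hx hy)).trans ?_
        rw [ENNReal.ofReal_mul (by positivity), intervalIntegral.integral_of_le zero_le_one]
        gcongr
        exact ofReal_integral_le' _ _
      · simp [hψz y hy]
    · simp [hψz x hx]
  have hfin : ENNReal.ofReal (∫ x, ∫ y, ψ x ^ 2 * ψ y ^ 2 * (w x - w y) ^ 2) ≤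
      ENNReal.ofReal (9 * r ^ 2 * (((3 * r / 2) ^ N * ω) * (2 ^ N * ∫ x, G x ^ 2))) := by
    refine (ofReal_integral_le' _ _).trans ?_
    refine (lintegral_mono fun x => ofReal_integral_le' _ _).trans ?_
    refine (lintegral_mono fun x => lintegral_mono fun y => hpt x y).trans ?_
    have e1 : ∀ x, ∫⁻ y, B.indicator (fun x => B.indicator (fun y => ENNReal.ofReal (9 * r ^ 2) *
        ∫⁻ τ in Ioc (0:ℝ) 1, H (x + τ • (y - x))) y) x = B.indicator (fun x => ENNReal.ofReal (9 * r ^ 2) * ∫⁻ y in B,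
        ∫⁻ τ in Ioc (0:ℝ) 1, H (x + τ • (y - x))) x := by
      intro x
      by_cases hx : x ∈ B
      · simp only [indicator_of_mem hx]
        rw [lintegral_indicator measurableSet_ball, lintegral_const_mul' _ _ ENNReal.ofReal_ne_top]
      · simp [hx]
    simp_rw [e1]
    rw [lintegral_indicator measurableSet_ball, lintegral_const_mul' _ _ ENNReal.ofReal_ne_top,
      ENNReal.ofReal_mul (p := 9 * r ^ 2) (by positivity)]
    gcongr
    refine (avg_line N B H hHm).trans (le_of_eq ?_)
    rw [hHi, ball_vol N hN _ _ (by positivity), ENNReal.ofReal_mul (p := (3 * r / 2) ^ N * ω) (by positivity),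
      ENNReal.ofReal_mul (p := 2 ^ N) (by positivity)]
  have hGn : 0 ≤ ∫ x, G x ^ 2 := integral_nonneg fun x => sq_nonneg _
  have hr0 := (ENNReal.ofReal_le_ofReal_iff (by positivity)).1 hfin
  rw [← hvar] at hr0
  rw [hGe]
  set D := ∫ x, G x ^ 2
  set I0 := ∫ x, ψ x ^ 2
  set V := ∫ x, ψ x ^ 2 * (w x - (∫ x, ψ x ^ 2 * w x) / I0) ^ 2
  have h5 : 2 * I0 * V ≤ 2 * I0 * (9 * 3 ^ N / 2 * r ^ 2 * D) := by
    refine hr0.trans ?_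
    calc 9 * r ^ 2 * (((3 * r / 2) ^ N * ω) * (2 ^ N * D)) = 9 * r ^ 2 * 3 ^ N * D * (r ^ N * ω) := by
          rw [show 3 * r / 2 = 3 / 2 * r by ring, mul_pow, div_pow]; field_simp
      _ ≤ 9 * r ^ 2 * 3 ^ N * D * I0 := by gcongr
      _ = _ := by ring
  exact le_of_mul_le_mul_left h5 (by positivity)

lemma param_cont (N : ℕ) (ρ : E N → ℝ) (O : Set (E N)) (I : Set ℝ) (hO : IsOpen O) (hI : IsOpen I)
    (hρ : Continuous ρ) (hk : HasCompactSupport ρ) (hs : tsupport ρ ⊆ O)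
    (F : E N × ℝ → ℝ) (hF : ContinuousOn F (O ×ˢ I)) :
    ContinuousOn (fun t => ∫ x, ρ x * F (x, t)) I := by
  refine continuousOn_integral_of_compact_support (f := fun t x => ρ x * F (x, t)) (k := tsupport ρ) hk ?_ ?_
  · rintro ⟨t, x⟩ ⟨ht, -⟩
    apply ContinuousAt.continuousWithinAt
    by_cases hx : x ∈ tsupport ρ
    · have h1 : ContinuousAt F (x, t) := hF.continuousAt ((hO.prod hI).mem_nhds ⟨hs hx, ht⟩)
      have h2 : ContinuousAt (fun q : ℝ × E N => F (q.2, q.1)) (t, x) :=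
        ContinuousAt.comp (f := fun q : ℝ × E N => (q.2, q.1)) h1 (by fun_prop)
      exact (hρ.comp continuous_snd).continuousAt.mul h2
    · have h1 : ρ =ᶠ[nhds x] 0 := notMem_tsupport_iff_eventuallyEq.1 hx
      have h3 : ∀ᶠ q : ℝ × E N in nhds (t, x), ρ q.2 = 0 :=
        (continuous_snd.tendsto (t, x)).eventually h1
      have h2 : (Function.uncurry fun t x => ρ x * F (x, t)) =ᶠ[nhds (t, x)] fun _ => 0 := by
        filter_upwards [h3] with y hy; simp [Function.uncurry, hy]
      exact (continuousAt_congr h2).2 continuousAt_const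
  · intro t x _ hx
    rw [image_eq_zero_of_notMem_tsupport hx, zero_mul]

lemma slice_integrable (N : ℕ) (ρ : E N → ℝ) (O : Set (E N)) (I : Set ℝ) (hO : IsOpen O)
    (hρ : Continuous ρ) (hk : HasCompactSupport ρ) (hs : tsupport ρ ⊆ O)
    (F : E N × ℝ → ℝ) (hF : ContinuousOn F (O ×ˢ I)) (t : ℝ) (ht : t ∈ I) :
    Integrable (fun x => ρ x * F (x, t)) := by
  have : ContinuousOn (fun x => F (x, t)) O :=
    hF.comp (by fun_prop) (fun x hx => ⟨hx, ht⟩)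
  exact (cont_mul_supp _ _ _ hO hρ hs this).integrable_of_hasCompactSupport hk.mul_right

lemma param_deriv (N : ℕ) (ρ : E N → ℝ) (O : Set (E N)) (I : Set ℝ) (hO : IsOpen O) (hI : IsOpen I)
    (hρ : Continuous ρ) (hk : HasCompactSupport ρ) (hs : tsupport ρ ⊆ O)
    (W : E N × ℝ → ℝ) (hW : ContDiffOn ℝ 1 W (O ×ˢ I)) (t : ℝ) (ht : t ∈ I) :
    HasDerivAt (fun t => ∫ x, ρ x * W (x, t)) (∫ x, ρ x * fderiv ℝ W (x, t) (0, 1)) t := by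
  have hop : IsOpen (O ×ˢ I) := hO.prod hI
  have hfd : ContinuousOn (fun p => fderiv ℝ W p (0, 1)) (O ×ˢ I) :=
    (hW.continuousOn_fderiv_of_isOpen hop le_rfl).clm_apply continuousOn_const
  obtain ⟨ε, hε, hball⟩ := Metric.nhds_basis_closedBall.mem_iff.1 (hI.mem_nhds ht)
  obtain ⟨M, hM⟩ := ((show IsCompact (tsupport ρ) from hk).prod (isCompact_closedBall t ε)).exists_bound_of_continuousOn
    (hfd.mono (prod_mono hs hball))
  have hder : ∀ x ∈ O, ∀ t' ∈ I, HasDerivAt (fun t => W (x, t)) (fderiv ℝ W (x, t') (0, 1)) t' := by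
    intro x hx t' ht'
    have hd : DifferentiableAt ℝ W (x, t') :=
      ((hW.differentiableOn one_ne_zero) _ ⟨hx, ht'⟩).differentiableAt (hop.mem_nhds ⟨hx, ht'⟩)
    have hl : HasDerivAt (fun t : ℝ => (x, t)) ((0 : E N), (1:ℝ)) t' :=
      (hasDerivAt_const t' x).prodMk (hasDerivAt_id t')
    exact hd.hasFDerivAt.comp_hasDerivAt t' hl
  refine (hasDerivAt_integral_of_dominated_loc_of_deriv_le (s := closedBall t ε)
    (F := fun t x => ρ x * W (x, t)) (F' := fun t x => ρ x * fderiv ℝ W (x, t) (0, 1))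
    (bound := fun x => |ρ x| * M) (closedBall_mem_nhds t hε) ?_ ?_ ?_ ?_ ?_ ?_).2
  · filter_upwards [hI.mem_nhds ht] with t' ht'
    exact (slice_integrable N ρ O I hO hρ hk hs W hW.continuousOn t' ht').aestronglyMeasurable
  · exact slice_integrable N ρ O I hO hρ hk hs W hW.continuousOn t ht
  · exact (slice_integrable N ρ O I hO hρ hk hs _ hfd t ht).aestronglyMeasurable
  · refine .of_forall fun x t' ht' => ?_
    rw [norm_mul, Real.norm_eq_abs]
    by_cases hx : x ∈ tsupport ρ
    · gcongr; exact hM (x, t') ⟨hx, ht'⟩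
    · simp [image_eq_zero_of_notMem_tsupport hx]
  · exact (hρ.abs.integrable_of_hasCompactSupport hk.norm).mul_const M
  · refine .of_forall fun x t' ht' => ?_
    by_cases hx : x ∈ tsupport ρ
    · exact (hder x (hs hx) t' (hball ht')).const_mul _
    · simp only [image_eq_zero_of_notMem_tsupport hx, zero_mul]
      exact hasDerivAt_const _ _

lemma localize (I : Set ℝ) (hI : IsOpen I) (P : ℝ → ℝ) (hP : ContinuousOn P I)
    (h : ∀ η : ℝ → ℝ, ContDiff ℝ (⊤ : ℕ∞) η → HasCompactSupport η → tsupport η ⊆ I → (∀ t, 0 ≤ η t) →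
      0 ≤ ∫ t, η t * P t) (t : ℝ) (ht : t ∈ I) : 0 ≤ P t := by
  by_contra hneg
  push Not at hneg
  have h1 : ∀ᶠ t' in nhds t, P t' < 0 := (hP.continuousAt (hI.mem_nhds ht)).eventually_lt continuousAt_const hneg
  obtain ⟨ε, hε, hball⟩ := Metric.nhds_basis_closedBall.mem_iff.1 (Filter.inter_mem h1 (hI.mem_nhds ht))
  let f : ContDiffBump t := ⟨ε / 2, ε, by positivity, by linarith⟩
  have hts : tsupport (f : ℝ → ℝ) = closedBall t ε := f.tsupport_eq
  have h2 := h f f.contDiff f.hasCompactSupport (by rw [hts]; exact fun x hx => (hball hx).2) (fun t => f.nonneg)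
  have hc : Continuous fun t => f t * P t := cont_mul_supp _ _ I hI f.continuous (by rw [hts]; exact fun x hx => (hball hx).2) hP
  have hle : ∀ s, f s * P s ≤ 0 := by
    intro s
    by_cases hs : s ∈ tsupport (f : ℝ → ℝ)
    · rw [hts] at hs
      exact mul_nonpos_of_nonneg_of_nonpos f.nonneg (le_of_lt (hball hs).1)
    · simp [image_eq_zero_of_notMem_tsupport hs]
  have h3 : 0 < ∫ s, -(f s * P s) := by
    refine Continuous.integral_pos_of_hasCompactSupport_nonneg_nonzero (x := t) hc.neg ?_ (fun s => by simpa using hle s) ?_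
    · exact (f.hasCompactSupport.mul_right (f' := P)).neg
    · have : f t = 1 := f.one_of_mem_closedBall (mem_closedBall_self (by positivity))
      simp [this, hneg.ne]
  rw [integral_neg] at h3
  linarith

lemma int_le_of_nonneg {α : Type*} [MeasurableSpace α] (μ : Measure α) (f g : α → ℝ)
    (h : ∀ᵐ x ∂μ, f x ≤ g x) (hg : ∀ x, 0 ≤ g x) (hgi : Integrable g μ) : ∫ x, f x ∂μ ≤ ∫ x, g x ∂μ := by
  by_cases hf : Integrable f μ
  · exact integral_mono_ae hf hgi h
  · rw [integral_undef hf]; exact integral_nonneg hg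

lemma theta_tsupport (N : ℕ) (ψ : E N → ℝ) (η : ℝ → ℝ) :
    tsupport (fun p : E N × ℝ => η p.2 * ψ p.1 ^ 2) ⊆ tsupport ψ ×ˢ tsupport η := by
  refine closure_minimal ?_ ((isClosed_tsupport ψ).prod (isClosed_tsupport η))
  rintro ⟨x, t⟩ h
  simp only [Function.mem_support, ne_eq, mul_eq_zero, not_or] at h
  refine ⟨subset_tsupport _ ?_, subset_tsupport _ h.1⟩
  intro h'; apply h.2; simp [h']

lemma theta_compact (N : ℕ) (ψ : E N → ℝ) (η : ℝ → ℝ) (hψk : HasCompactSupport ψ)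
    (hηk : HasCompactSupport η) :
    HasCompactSupport (fun p : E N × ℝ => η p.2 * ψ p.1 ^ 2) :=
  (IsCompact.prod hψk hηk).of_isClosed_subset (isClosed_tsupport _) (theta_tsupport N ψ η)

lemma tsupport_mul_sub {X : Type*} [TopologicalSpace X] (ψ f : X → ℝ) :
    tsupport (fun x => ψ x * f x) ⊆ tsupport ψ := tsupport_mul_subset_left

lemma J1_calc (N : ℕ) (Ω O : Set (E N)) (I : Set ℝ) (T l : ℝ) (u : E N → ℝ → ℝ) (ψ : E N → ℝ) (η : ℝ → ℝ)
    (hO : IsOpen O) (hI : IsOpen I) (hOΩ : O ⊆ Ω) (hIT : I ⊆ Ioo 0 T)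
    (hU : ContDiffOn ℝ (⊤ : ℕ∞) (fun p : E N × ℝ => u p.1 p.2) (O ×ˢ I))
    (hl : ∀ x ∈ O, ∀ t ∈ I, 0 < u x t + l)
    (hψ : ContDiff ℝ (⊤ : ℕ∞) ψ) (hψk : HasCompactSupport ψ) (hψs : tsupport ψ ⊆ O)
    (hη : ContDiff ℝ (⊤ : ℕ∞) η) (hηk : HasCompactSupport η) (hηs : tsupport η ⊆ I) :
    ∫ t in Ioo 0 T, ∫ x in Ω, u x t * deriv (fun τ => η τ * ψ x ^ 2 / (u x τ + l)) t =
      -∫ t, η t * ∫ x, ψ x ^ 2 * (fderiv ℝ (fun p : E N × ℝ => u p.1 p.2) (x, t) (0, 1) / (u x t + l)) := by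
  set U : E N × ℝ → ℝ := fun p => u p.1 p.2 with hUd
  set V := O ×ˢ I with hV
  have hVo : IsOpen V := hO.prod hI
  set θ : E N × ℝ → ℝ := fun p => η p.2 * ψ p.1 ^ 2 with hθ
  have hθc : ContDiff ℝ (⊤ : ℕ∞) θ := by fun_prop
  have hθt : tsupport θ ⊆ tsupport ψ ×ˢ tsupport η := theta_tsupport N ψ η
  have hθs : tsupport θ ⊆ V := hθt.trans (prod_mono hψs hηs)
  have hθk : HasCompactSupport θ := theta_compact N ψ η hψk hηk
  have hne : ∀ p ∈ V, U p + l ≠ 0 := fun p hp => (hl p.1 hp.1 p.2 hp.2).ne'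
  set Φ : E N × ℝ → ℝ := fun p => θ p * (U p + l)⁻¹ with hΦ
  have hΦc : ContDiff ℝ (⊤ : ℕ∞) Φ :=
    contDiff_mul_supp θ _ V hVo hθc hθs ((hU.add contDiffOn_const).inv hne)
  set h : E N × ℝ → ℝ := fun p => θ p * (U p * (U p + l)⁻¹) with hh
  have hhc : ContDiff ℝ (⊤ : ℕ∞) h :=
    contDiff_mul_supp θ _ V hVo hθc hθs (hU.mul ((hU.add contDiffOn_const).inv hne))
  have hhk : HasCompactSupport h := hθk.mul_right
  have hUd1 : ∀ p ∈ V, DifferentiableAt ℝ U p := fun p hp =>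
    (hU.differentiableOn (by simp) p hp).differentiableAt (hVo.mem_nhds hp)
  set F2 : E N × ℝ → ℝ := fun p => fderiv ℝ h p (0, 1) with hF2
  set F3 : E N × ℝ → ℝ := fun p => θ p * (fderiv ℝ U p (0, 1) / (U p + l)) with hF3
  have hfU : ContinuousOn (fun p => fderiv ℝ U p (0, 1) / (U p + l)) V :=
    ((hU.continuousOn_fderiv_of_isOpen hVo (by simp)).clm_apply continuousOn_const).div
      (hU.continuousOn.add continuousOn_const) hne
  have hF3i : Integrable F3 (volume.prod volume) :=
    (cont_mul_supp θ _ V hVo hθc.continuous hθs hfU).integrable_of_hasCompactSupport hθk.mul_right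
  have hF2c : Continuous F2 := (hhc.continuous_fderiv (by simp)).clm_apply continuous_const
  have hF2k : HasCompactSupport F2 := HasCompactSupport.fderiv_apply (𝕜 := ℝ) hhk (0, 1)
  have hF2i : Integrable F2 (volume.prod volume) := hF2c.integrable_of_hasCompactSupport hF2k
  have hline : ∀ (x : E N) (t : ℝ), HasDerivAt (fun t : ℝ => (x, t)) ((0 : E N), (1:ℝ)) t := fun x t =>
      (hasDerivAt_const t x).prodMk (hasDerivAt_id t)
  -- pointwise identity
  have hpt : ∀ x t, u x t * deriv (fun τ => η τ * ψ x ^ 2 / (u x τ + l)) t = F2 (x, t) - F3 (x, t) := by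
    intro x t
    have e0 : (fun τ => η τ * ψ x ^ 2 / (u x τ + l)) = fun τ => Φ (x, τ) := by
      ext τ; simp [hΦ, hθ, hUd, div_eq_mul_inv]
    have e1 : deriv (fun τ => Φ (x, τ)) t = fderiv ℝ Φ (x, t) (0, 1) :=
      ((hΦc.differentiable (by simp) (x, t)).hasFDerivAt.comp_hasDerivAt t (hline x t)).deriv
    rw [e0, e1]
    by_cases hp : (x, t) ∈ V
    · have hhe : h = fun p => U p * Φ p := by ext p; simp only [hh, hΦ]; ring
      have := ((hUd1 _ hp).hasFDerivAt.mul (hΦc.differentiable (by simp) (x, t)).hasFDerivAt).fderiv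
      have e2 : F2 (x, t) = U (x, t) * fderiv ℝ Φ (x, t) (0, 1) + Φ (x, t) * fderiv ℝ U (x, t) (0, 1) := by
        simp only [hF2]
        rw [hhe]
        erw [this]
        simp
      rw [e2]
      simp only [hF3, hΦ]
      change U (x, t) * _ = _
      ring
    · have hp' : (x, t) ∉ tsupport θ := fun h' => hp (hθs h')
      have z1 : θ =ᶠ[nhds (x, t)] 0 := notMem_tsupport_iff_eventuallyEq.1 hp'
      have z2 : Φ =ᶠ[nhds (x, t)] fun _ => 0 := by filter_upwards [z1] with q hq; simp [hΦ, hq]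
      have z3 : h =ᶠ[nhds (x, t)] fun _ => 0 := by filter_upwards [z1] with q hq; simp [hh, hq]
      have z4 : θ (x, t) = 0 := image_eq_zero_of_notMem_tsupport hp'
      simp only [hF2, hF3, z2.fderiv_eq, z3.fderiv_eq, z4]
      simp
  have hz : ∀ p, p ∉ V → F2 p - F3 p = 0 := by
    intro p hp
    have hp' : p ∉ tsupport θ := fun h' => hp (hθs h')
    have z1 : θ =ᶠ[nhds p] 0 := notMem_tsupport_iff_eventuallyEq.1 hp'
    have z3 : h =ᶠ[nhds p] fun _ => 0 := by filter_upwards [z1] with q hq; simp [hh, hq]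
    have z4 : θ p = 0 := image_eq_zero_of_notMem_tsupport hp'
    simp only [hF2, hF3, z3.fderiv_eq, z4]
    simp
  simp_rw [hpt]
  have s1 : ∀ t, ∫ x in Ω, (F2 (x, t) - F3 (x, t)) = ∫ x, (F2 (x, t) - F3 (x, t)) := by
    intro t
    exact setIntegral_eq_integral_of_forall_compl_eq_zero fun x hx => hz _ fun h' => hx (hOΩ h'.1)
  simp_rw [s1]
  rw [setIntegral_eq_integral_of_forall_compl_eq_zero (f := fun t => ∫ x, (F2 (x, t) - F3 (x, t)))]
  swap
  · intro t ht
    rw [integral_congr_ae (g := fun _ => (0:ℝ))]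
    · simp
    · exact .of_forall fun x => hz _ fun h' => ht (hIT h'.2)
  have s2 : ∫ t, ∫ x, (F2 (x, t) - F3 (x, t)) = ∫ p, (F2 p - F3 p) ∂(volume.prod volume) :=
    (integral_prod_symm (fun p => F2 p - F3 p) (hF2i.sub hF3i)).symm
  rw [s2, integral_sub hF2i hF3i]
  have s3 : ∫ p, F2 p ∂(volume.prod volume) = 0 := by
    rw [integral_prod _ hF2i]
    have : ∀ x, ∫ t, F2 (x, t) = 0 := by
      intro x
      have cemb : Topology.IsClosedEmbedding (fun t : ℝ => (x, t)) :=
        Topology.IsClosedEmbedding.of_continuous_injective_isClosedMap (by fun_prop) (fun a b h => by simpa using h)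
          (isClosedMap_prodMk_left x)
      refine integral_eq_zero_of_hasDerivAt_of_integrable (f := fun t => h (x, t)) ?_ ?_ ?_
      · intro t
        exact (hhc.differentiable (by simp) (x, t)).hasFDerivAt.comp_hasDerivAt t (hline x t)
      · exact (hF2c.comp (by fun_prop)).integrable_of_hasCompactSupport (hF2k.comp_isClosedEmbedding cemb)
      · exact (hhc.continuous.comp (by fun_prop)).integrable_of_hasCompactSupport (hhk.comp_isClosedEmbedding cemb)
    simp [this]
  rw [s3, zero_sub, integral_prod_symm _ hF3i]
  congr 2; ext t
  rw [← integral_const_mul]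
  congr 1; ext x
  simp only [hF3, hθ, hUd]; ring

lemma inner_grad (N : ℕ) (f g : E N → ℝ) (x : E N) :
    ⟪gradient f x, gradient g x⟫ = fderiv ℝ f x (gradient g x) := by
  unfold gradient
  rw [InnerProductSpace.toDual_symm_apply]

lemma norm_grad (N : ℕ) (f : E N → ℝ) (x : E N) : ‖gradient f x‖ = ‖fderiv ℝ f x‖ := by
  unfold gradient; simp

/-- gradient-term density -/
def qden (N : ℕ) (u : E N → ℝ → ℝ) (l : ℝ) (ψ : E N → ℝ) (p : E N × ℝ) : ℝ :=
  2 / (u p.1 p.2 + l) * fderiv ℝ (fun y => u y p.2) p.1 (gradient ψ p.1) -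
    ψ p.1 / (u p.1 p.2 + l) ^ 2 * ‖fderiv ℝ (fun y => u y p.2) p.1‖ ^ 2

lemma slice_fderiv (N : ℕ) (u : E N → ℝ → ℝ) (p : E N × ℝ)
    (h : DifferentiableAt ℝ (fun p : E N × ℝ => u p.1 p.2) p) :
    HasFDerivAt (fun y => u y p.2) ((fderiv ℝ (fun p : E N × ℝ => u p.1 p.2) p).comp (ContinuousLinearMap.inl ℝ (E N) ℝ)) p.1 := by
  have := h.hasFDerivAt
  exact HasFDerivAt.comp (f := fun y : E N => (y, p.2)) p.1 this (hasFDerivAt_prodMk_left p.1 p.2)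

lemma qden_cont (N : ℕ) (O : Set (E N)) (I : Set ℝ) (l : ℝ) (u : E N → ℝ → ℝ) (ψ : E N → ℝ)
    (hO : IsOpen O) (hI : IsOpen I)
    (hU : ContDiffOn ℝ (⊤ : ℕ∞) (fun p : E N × ℝ => u p.1 p.2) (O ×ˢ I))
    (hl : ∀ x ∈ O, ∀ t ∈ I, 0 < u x t + l)
    (hψ : ContDiff ℝ (⊤ : ℕ∞) ψ) : ContinuousOn (qden N u l ψ) (O ×ˢ I) := by
  set U : E N × ℝ → ℝ := fun p => u p.1 p.2 with hUd
  have hVo : IsOpen (O ×ˢ I) := hO.prod hI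
  have hne : ∀ p ∈ O ×ˢ I, U p + l ≠ 0 := fun p hp => (hl p.1 hp.1 p.2 hp.2).ne'
  have hfU : ContinuousOn (fderiv ℝ U) (O ×ˢ I) := hU.continuousOn_fderiv_of_isOpen hVo (by simp)
  have hfs : ContinuousOn (fun p : E N × ℝ => fderiv ℝ (fun y => u y p.2) p.1) (O ×ˢ I) := by
    have h1 : ContinuousOn (fun p : E N × ℝ => (fderiv ℝ U p).comp (ContinuousLinearMap.inl ℝ (E N) ℝ)) (O ×ˢ I) :=
      hfU.clm_comp continuousOn_const
    refine h1.congr fun p hp => ?_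
    exact (slice_fderiv N u p ((hU.differentiableOn (by simp) p hp).differentiableAt (hVo.mem_nhds hp))).fderiv
  have hgψ : Continuous (gradient ψ) := by
    unfold gradient
    exact (LinearIsometryEquiv.continuous _).comp (hψ.continuous_fderiv (by simp))
  have hUl : ContinuousOn (fun p : E N × ℝ => u p.1 p.2 + l) (O ×ˢ I) := hU.continuousOn.add continuousOn_const
  unfold qden
  refine ContinuousOn.sub ?_ ?_
  · refine (continuousOn_const.div hUl hne).mul ?_
    exact hfs.clm_apply (hgψ.comp continuous_fst).continuousOn
  · refine ContinuousOn.mul ?_ (hfs.norm.pow 2)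
    exact (hψ.continuous.comp continuous_fst).continuousOn.div (hUl.pow 2) fun p hp => pow_ne_zero 2 (hne p hp)

lemma J2_calc (N : ℕ) (Ω O : Set (E N)) (I : Set ℝ) (T l : ℝ) (u : E N → ℝ → ℝ) (ψ : E N → ℝ) (η : ℝ → ℝ)
    (hO : IsOpen O) (hI : IsOpen I) (hOΩ : O ⊆ Ω) (hIT : I ⊆ Ioo 0 T)
    (hU : ContDiffOn ℝ (⊤ : ℕ∞) (fun p : E N × ℝ => u p.1 p.2) (O ×ˢ I))
    (hl : ∀ x ∈ O, ∀ t ∈ I, 0 < u x t + l)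
    (hψ : ContDiff ℝ (⊤ : ℕ∞) ψ) (hψs : tsupport ψ ⊆ O)
    (hηs : tsupport η ⊆ I) :
    ∫ t in Ioo 0 T, ∫ x in Ω, ⟪gradient (fun y => u y t) x,
        gradient (fun y => η t * ψ y ^ 2 / (u y t + l)) x⟫ =
      ∫ t, η t * ∫ x, ψ x * qden N u l ψ (x, t) := by
  have hVo : IsOpen (O ×ˢ I) := hO.prod hI
  have hz : ∀ t, t ∉ I → η t = 0 := fun t ht => image_eq_zero_of_notMem_tsupport fun h => ht (hηs h)
  have hpt : ∀ x t, ⟪gradient (fun y => u y t) x, gradient (fun y => η t * ψ y ^ 2 / (u y t + l)) x⟫ =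
      η t * (ψ x * qden N u l ψ (x, t)) := by
    intro x t
    by_cases ht : t ∈ I
    · by_cases hx : x ∈ O
      · have hd := (slice_fderiv N u (x, t) ((hU.differentiableOn (by simp) (x, t) ⟨hx, ht⟩).differentiableAt
          (hVo.mem_nhds ⟨hx, ht⟩))).differentiableAt.hasFDerivAt
        simp only at hd
        have hv : u x t + l ≠ 0 := (hl x hx t ht).ne'
        have hψd := (hψ.differentiable (by simp) x).hasFDerivAt
        have h1 := ((hψd.pow 2).const_mul (η t)).mul ((hasDerivAt_inv hv).comp_hasFDerivAt x (hd.add_const l))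
        have h2 := h1.fderiv
        have h3 : ((fun y => η t * ψ y ^ 2) * (fun y => y⁻¹) ∘ fun x => u x t + l) =
            (fun y => η t * ψ y ^ 2 / (u y t + l)) := by
          ext y; simp [div_eq_mul_inv]
        rw [h3] at h2
        rw [real_inner_comm, inner_grad, h2]
        unfold qden
        have e1 : fderiv ℝ ψ x (gradient (fun y => u y t) x) = fderiv ℝ (fun y => u y t) x (gradient ψ x) := by
          rw [← inner_grad, ← inner_grad, real_inner_comm]
        have e2 : fderiv ℝ (fun y => u y t) x (gradient (fun y => u y t) x) = ‖fderiv ℝ (fun y => u y t) x‖ ^ 2 := by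
          rw [← inner_grad, real_inner_self_eq_norm_sq, norm_grad]
        simp [e1, e2]
        field_simp
        ring
      · have hx' : x ∉ tsupport ψ := fun h => hx (hψs h)
        have z1 : ψ =ᶠ[nhds x] 0 := notMem_tsupport_iff_eventuallyEq.1 hx'
        have z2 : (fun y => η t * ψ y ^ 2 / (u y t + l)) =ᶠ[nhds x] fun _ => 0 := by
          filter_upwards [z1] with y hy; simp [hy]
        have z3 : gradient (fun y => η t * ψ y ^ 2 / (u y t + l)) x = 0 := by
          unfold gradient; rw [z2.fderiv_eq]; simp
        rw [z3, image_eq_zero_of_notMem_tsupport hx']; simp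
    · have z3 : gradient (fun y => η t * ψ y ^ 2 / (u y t + l)) x = 0 := by
        unfold gradient; simp [hz t ht]
      rw [z3, hz t ht]; simp
  simp_rw [hpt]
  have s1 : ∀ t, ∫ x in Ω, η t * (ψ x * qden N u l ψ (x, t)) = η t * ∫ x, ψ x * qden N u l ψ (x, t) := by
    intro t
    rw [setIntegral_eq_integral_of_forall_compl_eq_zero, integral_const_mul]
    intro x hx
    rw [image_eq_zero_of_notMem_tsupport fun h => hx (hOΩ (hψs h))]; simp
  simp_rw [s1]
  exact setIntegral_eq_integral_of_forall_compl_eq_zero fun t ht => by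
    rw [hz t fun h => ht (hIT h), zero_mul]

lemma tail_int (N : ℕ) (hN : 2 ≤ N) (s : ℝ) (hs : s ∈ Ioo (0:ℝ) 1) (x₀ : E N) (R : ℝ) (hR : 0 < R) :
    IntegrableOn (fun y : E N => ‖y - x₀‖ ^ (-((N : ℝ) + 2 * s))) (ball x₀ R)ᶜ := by
  have h := ((mker_integrable N hN s (1 / R) hs).comp_sub_right x₀).integrableOn (s := (ball x₀ R)ᶜ)
  refine h.congr_fun (fun y hy => ?_) measurableSet_ball.compl
  have hy' : R ≤ ‖y - x₀‖ := by simpa [dist_eq_norm] using hy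
  have : 1 ≤ (1 / R) ^ 2 * ‖y - x₀‖ ^ 2 := by
    rw [← mul_pow, one_div, ← div_eq_inv_mul]
    exact one_le_pow₀ ((one_le_div hR).2 hy')
  simp only [mker]
  rw [min_eq_right this, one_mul]

lemma tail_facts (N : ℕ) (hN : 2 ≤ N) (s : ℝ) (hs : s ∈ Ioo (0:ℝ) 1) (x₀ : E N) (R a b T : ℝ) (hR : 0 < R)
    (hab : a < b) (hI : Ioo a b ⊆ Ioo 0 T) (u : E N → ℝ → ℝ) (hum : Measurable (fun p : E N × ℝ => u p.1 p.2))
    (hub : ∃ M : ℝ, ∀ x t, t ∈ Set.Ioo 0 T → |u x t| ≤ M) :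
    ∃ S, 0 ≤ S ∧ tailInfty N s (uminus N u) x₀ R a b = R ^ 2 * S ∧
      ∀ᵐ t ∂(volume.restrict (Ioo a b)),
        ∫⁻ y in (ball x₀ R)ᶜ, ENNReal.ofReal (max (-u y t) 0 * ‖y - x₀‖ ^ (-((N:ℝ) + 2 * s))) ≤ ENNReal.ofReal S := by
  obtain ⟨M, hM⟩ := hub
  set f : ℝ → ℝ := fun t => ∫ y in (ball x₀ R)ᶜ, |uminus N u y t| * ‖y - x₀‖ ^ (-((N : ℝ) + 2 * s)) with hf
  have hk := tail_int N hN s hs x₀ R hR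
  have hbd : ∀ t ∈ Ioo a b, ∀ y, |uminus N u y t| ≤ M := by
    intro t ht y
    have h1 := hM y t (hI ht)
    unfold uminus
    rw [abs_of_nonneg (le_max_right _ _)]
    exact max_le ((neg_le_abs _).trans h1) ((abs_nonneg _).trans h1)
  have hmeas : ∀ t, Measurable (fun y => |uminus N u y t|) := by
    intro t
    have : Measurable (fun y => u y t) := hum.comp (measurable_id.prodMk measurable_const)
    unfold uminus
    exact (this.neg.max measurable_const).abs
  have hint : ∀ t ∈ Ioo a b, IntegrableOn (fun y => |uminus N u y t| * ‖y - x₀‖ ^ (-((N : ℝ) + 2 * s))) (ball x₀ R)ᶜ := by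
    intro t ht
    refine Integrable.bdd_mul (c := M) hk (hmeas t).aestronglyMeasurable (.of_forall fun y => ?_)
    simpa using hbd t ht y
  have hfb : ∀ t ∈ Ioo a b, f t ≤ ∫ y in (ball x₀ R)ᶜ, M * ‖y - x₀‖ ^ (-((N : ℝ) + 2 * s)) := by
    intro t ht
    refine integral_mono (hint t ht) (hk.const_mul M) fun y => ?_
    exact mul_le_mul_of_nonneg_right (hbd t ht y) (Real.rpow_nonneg (norm_nonneg _) _)
  have hae : ∀ᵐ t ∂(volume.restrict (Ioo a b)), f t ≤ essSup f (volume.restrict (Ioo a b)) := by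
    apply ae_le_essSup
    refine ⟨∫ y in (ball x₀ R)ᶜ, M * ‖y - x₀‖ ^ (-((N : ℝ) + 2 * s)), ?_⟩
    simp only [Filter.eventually_map]
    filter_upwards [ae_restrict_mem measurableSet_Ioo] with t ht using hfb t ht
  have hf0 : ∀ t, 0 ≤ f t := fun t => integral_nonneg fun y => by positivity
  refine ⟨essSup f (volume.restrict (Ioo a b)), ?_, rfl, ?_⟩
  · have : (ae (volume.restrict (Ioo a b))).NeBot := by
      rw [ae_neBot, Ne, Measure.restrict_eq_zero]
      simp [hab]
    obtain ⟨t, ht⟩ := hae.exists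
    exact (hf0 t).trans ht
  · filter_upwards [hae, ae_restrict_mem measurableSet_Ioo] with t ht htI
    refine le_trans (le_of_eq ?_) (ENNReal.ofReal_le_ofReal ht)
    rw [hf, ofReal_integral_eq_lintegral_ofReal (hint t htI) (.of_forall fun y => by positivity)]
    refine lintegral_congr fun y => ?_
    unfold uminus
    rw [abs_of_nonneg (le_max_right _ _)]

lemma psi_lip (N : ℕ) (ψ : E N → ℝ) (x₀ : E N) (r C₀ : ℝ) (hr : 0 < r) (hC₀ : 0 < C₀)
    (hψ : ContDiff ℝ (⊤ : ℕ∞) ψ) (hψs : tsupport ψ ⊆ ball x₀ (3 * r / 2))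
    (hg : ∀ x ∈ ball x₀ (3 * r / 2), ‖gradient ψ x‖ ≤ C₀ / r) :
    (∀ x, ‖fderiv ℝ ψ x‖ ≤ C₀ / r) ∧ ∀ x y, |ψ x - ψ y| ≤ C₀ / r * ‖x - y‖ := by
  have h1 : ∀ x, ‖fderiv ℝ ψ x‖ ≤ C₀ / r := by
    intro x
    by_cases hx : x ∈ ball x₀ (3 * r / 2)
    · rw [← norm_grad]; exact hg x hx
    · have z1 : ψ =ᶠ[nhds x] 0 := notMem_tsupport_iff_eventuallyEq.1 fun h => hx (hψs h)
      rw [z1.fderiv_eq]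
      simp; positivity
  refine ⟨h1, fun x y => ?_⟩
  have := Convex.norm_image_sub_le_of_norm_fderiv_le (𝕜 := ℝ) (f := ψ) (s := univ) (x := y) (y := x)
    (fun x _ => hψ.differentiable (by simp) x) (fun x _ => h1 x) convex_univ (mem_univ _) (mem_univ _)
  simpa using this

lemma energy_weak (N : ℕ) (hN : 2 ≤ N) (s Λ C₀ : ℝ) (hs : s ∈ Set.Ioo (0 : ℝ) 1)
    (hΛ : 1 ≤ Λ) (hC₀ : 0 < C₀) :
    ∃ C : ℝ, 0 ≤ C ∧
      ∀ (T : ℝ) (Ω : Set (E N)) (K : E N → E N → ℝ → ℝ) (u : E N → ℝ → ℝ)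
        (x₀ : E N) (R r a b l S : ℝ) (ψ : E N → ℝ),
        KernelOK N s Λ T K → IsWeakSupersolution N T K Ω u →
        Metric.ball x₀ R ⊆ Ω → Set.Ioo a b ⊆ Set.Ioo 0 T →
        (∀ x ∈ Metric.ball x₀ R, ∀ t ∈ Set.Ioo a b, 0 ≤ u x t) →
        0 < r → r ≤ 1 → r < R / 2 → 0 < l → 0 ≤ S → r ^ 2 * S ≤ l →
        (∀ᵐ t ∂(volume.restrict (Ioo a b)),
          ∫⁻ y in (ball x₀ R)ᶜ, ENNReal.ofReal (max (-u y t) 0 * ‖y - x₀‖ ^ (-((N:ℝ) + 2 * s))) ≤ ENNReal.ofReal S) →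
        ContDiff ℝ (⊤ : ℕ∞) ψ → HasCompactSupport ψ →
        tsupport ψ ⊆ Metric.ball x₀ (3 * r / 2) →
        (∀ x, 0 ≤ ψ x) → (∀ x, ψ x ≤ 1) →
        (∀ x y, |ψ x - ψ y| ≤ C₀ / r * ‖x - y‖) →
        ∀ t ∈ Ioo a b, 0 ≤ (∫ x, ψ x ^ 2 * (fderiv ℝ (fun p : E N × ℝ => u p.1 p.2) (x, t) (0, 1) / (u x t + l))) +
          (∫ x, ψ x * qden N u l ψ (x, t)) + C * r ^ N / r ^ 2 := by
  obtain ⟨C, hC, hnl⟩ := nonlocal_bound N hN s Λ C₀ hs hΛ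
  refine ⟨C, hC, ?_⟩
  intro T Ω K u x₀ R r a b l S ψ hK hu hOΩ hIT hu0 hr hr1 hrR hl hS0 hSl hS hψ hψk hψs hψ0 hψ1 hψL
  obtain ⟨hum, hub, hUs, hw⟩ := hu
  obtain ⟨hKm, hKs, hKb⟩ := hK
  set O := ball x₀ R with hO
  set I := Ioo a b with hI
  have hOo : IsOpen O := isOpen_ball
  have hIo : IsOpen I := isOpen_Ioo
  have hVo : IsOpen (O ×ˢ I) := hOo.prod hIo
  have hU : ContDiffOn ℝ (⊤ : ℕ∞) (fun p : E N × ℝ => u p.1 p.2) (O ×ˢ I) := hUs.mono (prod_mono hOΩ hIT)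
  have hv : ∀ x ∈ O, ∀ t ∈ I, 0 < u x t + l := fun x hx t ht => by linarith [hu0 x hx t ht]
  have hne : ∀ p ∈ O ×ˢ I, u p.1 p.2 + l ≠ 0 := fun p hp => (hv p.1 hp.1 p.2 hp.2).ne'
  have hψO : tsupport ψ ⊆ O := hψs.trans (ball_subset_ball (by linarith))
  have hψz : ∀ x, x ∉ ball x₀ (3 * r / 2) → ψ x = 0 := fun x hx =>
    image_eq_zero_of_notMem_tsupport fun h => hx (hψs h)
  have hψz' : ∀ x, x ∉ O → ψ x = 0 := fun x hx =>
    image_eq_zero_of_notMem_tsupport fun h => hx (hψO h)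
  set c := C * r ^ N / r ^ 2 with hc
  have hc0 : 0 ≤ c := by positivity
  have hψ2s : tsupport (fun x => ψ x ^ 2) ⊆ O := by
    refine (closure_mono fun x hx => ?_).trans hψO
    simp only [Function.mem_support] at hx ⊢
    exact fun h => hx (by simp [h])
  have hψ2k : HasCompactSupport (fun x => ψ x ^ 2) := by
    simpa [Function.comp_def] using hψk.comp_left (g := fun z : ℝ => z ^ 2) (by simp)
  have hcG : ContinuousOn (fun t => ∫ x, ψ x ^ 2 * (fderiv ℝ (fun p : E N × ℝ => u p.1 p.2) (x, t) (0, 1) / (u x t + l))) I :=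
    param_cont N (fun x => ψ x ^ 2) O I hOo hIo (hψ.continuous.pow 2) hψ2k hψ2s
      (fun p => fderiv ℝ (fun p : E N × ℝ => u p.1 p.2) p (0, 1) / (u p.1 p.2 + l))
      (((hU.continuousOn_fderiv_of_isOpen hVo (by simp)).clm_apply continuousOn_const).div
      (hU.continuousOn.add continuousOn_const) hne)
  have hcQ : ContinuousOn (fun t => ∫ x, ψ x * qden N u l ψ (x, t)) I :=
    param_cont N ψ O I hOo hIo hψ.continuous hψk hψO _ (qden_cont N O I l u ψ hOo hIo hU hv hψ)
  refine localize I hIo _ ((hcG.add hcQ).add continuousOn_const) ?_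
  intro η hη hηk hηs hη0
  have hηz : ∀ t, t ∉ I → η t = 0 := fun t ht => image_eq_zero_of_notMem_tsupport fun h => ht (hηs h)
  have hφ := hw (fun x t => η t * ψ x ^ 2 / (u x t + l)) ?_ ?_ ?_ ?_
  · rw [J1_calc N Ω O I T l u ψ η hOo hIo hOΩ hIT hU hv hψ hψk hψO hη hηk hηs,
      J2_calc N Ω O I T l u ψ η hOo hIo hOΩ hIT hU hv hψ hψO hηs] at hφ
    have hηi : Integrable η := hη.continuous.integrable_of_hasCompactSupport hηk
    have hJ3 : (∫ t in Set.Ioo 0 T, ∫ x : E N, ∫ y : E N,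
          (u x t - u y t) * (η t * ψ x ^ 2 / (u x t + l) - η t * ψ y ^ 2 / (u y t + l)) * K x y t) ≤ ∫ t, η t * c := by
      have e : ∫ t in Ioo 0 T, η t * c = ∫ t, η t * c :=
        setIntegral_eq_integral_of_forall_compl_eq_zero fun t ht => by rw [hηz t fun h => ht (hIT h), zero_mul]
      rw [← e]
      refine int_le_of_nonneg _ _ _ ?_ (fun t => mul_nonneg (hη0 t) hc0) (hηi.mul_const c).integrableOn
      have hS' := (ae_restrict_iff' measurableSet_Ioo).1 hS
      refine (ae_restrict_iff' measurableSet_Ioo).2 ?_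
      filter_upwards [hS'] with t ht htT
      by_cases htI : t ∈ I
      · exact hnl x₀ R r l (η t) S ψ (fun x => u x t) (fun x y => K x y t) hr hr1 hrR hl (hη0 t)
          (hum.comp (measurable_id.prodMk measurable_const)) hψ0 hψ1 hψz hψL (fun x hx => hu0 x hx t htI)
          (ht htI) hS0 hSl (fun x y hxy => ⟨le_trans (by positivity) (hKb x y hxy t htT).1, (hKb x y hxy t htT).2⟩)
      · simp [hηz t htI]
    have iη : ∀ P : ℝ → ℝ, ContinuousOn P I → Integrable (fun t => η t * P t) := fun P hP =>
      (cont_mul_supp η P I hIo hη.continuous hηs hP).integrable_of_hasCompactSupport hηk.mul_right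
    have i1 := iη _ hcG
    have i2 := iη _ hcQ
    have i3 : Integrable (fun t => η t * c) := hηi.mul_const c
    simp_rw [mul_add]
    rw [integral_add (i1.fun_add i2) i3, integral_add i1 i2]
    linarith
  · have := contDiff_mul_supp (fun p : E N × ℝ => η p.2 * ψ p.1 ^ 2) (fun p => (u p.1 p.2 + l)⁻¹) (O ×ˢ I) hVo
      (n := (⊤ : ℕ∞)) ((hη.comp contDiff_snd).mul ((hψ.comp contDiff_fst).pow 2))
      ((theta_tsupport N ψ η).trans (prod_mono hψO hηs)) ((hU.add contDiffOn_const).inv hne)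
    simpa [div_eq_mul_inv] using this
  · have := (theta_compact N ψ η hψk hηk).mul_right (f' := fun p => (u p.1 p.2 + l)⁻¹)
    simp only [div_eq_mul_inv]
    exact this
  · refine subset_trans (closure_mono fun p hp => ?_) ((theta_tsupport N ψ η).trans (prod_mono (hψO.trans hOΩ) (hηs.trans hIT)))
    simp only [Function.mem_support] at hp ⊢
    exact fun h => hp (by simp [h])
  · intro x t
    by_cases hx : x ∈ O
    · by_cases ht : t ∈ I
      · have := hv x hx t ht; have := hη0 t; positivity
      · simp [hηz t ht]
    · simp [hψz' x hx]

lemma logW_smooth (N : ℕ) (O : Set (E N)) (I : Set ℝ) (l : ℝ) (u : E N → ℝ → ℝ)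
    (hU : ContDiffOn ℝ (⊤ : ℕ∞) (fun p : E N × ℝ => u p.1 p.2) (O ×ˢ I))
    (hv : ∀ x ∈ O, ∀ t ∈ I, 0 < u x t + l) :
    ContDiffOn ℝ (⊤ : ℕ∞) (fun p : E N × ℝ => Real.log (u p.1 p.2 + l)) (O ×ˢ I) :=
  (hU.add contDiffOn_const).log fun p hp => (hv p.1 hp.1 p.2 hp.2).ne'

lemma hcs_sq {X : Type*} [TopologicalSpace X] (f : X → ℝ) (h : HasCompactSupport f) :
    HasCompactSupport (fun x => f x ^ 2) := by
  refine h.mono fun x hx => ?_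
  simp only [Function.mem_support] at hx ⊢
  exact fun h => hx (by rw [h]; norm_num)

lemma fderiv_norm_hcs (N : ℕ) (ψ : E N → ℝ) (hψk : HasCompactSupport ψ) :
    HasCompactSupport (fun x => ‖fderiv ℝ ψ x‖) := (HasCompactSupport.fderiv (𝕜 := ℝ) hψk).norm

lemma Q_bound (N : ℕ) (hN : 2 ≤ N) (x₀ : E N) (r R l C₀ : ℝ) (I : Set ℝ) (u : E N → ℝ → ℝ) (ψ : E N → ℝ)
    (hr : 0 < r) (hrR : 3 * r / 2 < R) (hI : IsOpen I)
    (hU : ContDiffOn ℝ (⊤ : ℕ∞) (fun p : E N × ℝ => u p.1 p.2) (ball x₀ R ×ˢ I))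
    (hv : ∀ x ∈ ball x₀ R, ∀ t ∈ I, 0 < u x t + l)
    (hψ : ContDiff ℝ (⊤ : ℕ∞) ψ) (hψk : HasCompactSupport ψ)
    (hψs : tsupport ψ ⊆ ball x₀ (3 * r / 2)) (hg : ∀ x, ‖fderiv ℝ ψ x‖ ≤ C₀ / r) (t : ℝ) (ht : t ∈ I) :
    ∫ x, ψ x * qden N u l ψ (x, t) ≤
      -(1 / 2) * (∫ x, ψ x ^ 2 * ‖fderiv ℝ (fun y => Real.log (u y t + l)) x‖ ^ 2) +
        2 * ((C₀ / r) ^ 2 * ((3 * r / 2) ^ N * volume.real (ball (0 : E N) 1))) := by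
  set O := ball x₀ R with hOd
  have hO : IsOpen O := isOpen_ball
  have hVo : IsOpen (O ×ˢ I) := hO.prod hI
  have hψO : tsupport ψ ⊆ O := hψs.trans (ball_subset_ball hrR.le)
  have hψ2s : tsupport (fun x => ψ x ^ 2) ⊆ O := by
    refine (closure_mono fun x hx => ?_).trans hψO
    simp only [Function.mem_support] at hx ⊢
    exact fun h => hx (by simp [h])
  have hψ2k : HasCompactSupport (fun x => ψ x ^ 2) := by
    simpa [Function.comp_def] using hψk.comp_left (g := fun z : ℝ => z ^ 2) (by simp)
  have hW := logW_smooth N O I l u hU hv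
  have hcW : ContinuousOn (fun p : E N × ℝ => ‖fderiv ℝ (fun y => Real.log (u y p.2 + l)) p.1‖ ^ 2) (O ×ˢ I) := by
    have h1 : ContinuousOn (fun p : E N × ℝ => (fderiv ℝ (fun p : E N × ℝ => Real.log (u p.1 p.2 + l)) p).comp
        (ContinuousLinearMap.inl ℝ (E N) ℝ)) (O ×ˢ I) :=
      (hW.continuousOn_fderiv_of_isOpen hVo (by simp)).clm_comp continuousOn_const
    refine (h1.congr fun p hp => ?_).norm.pow 2
    exact (slice_fderiv N (fun x t => Real.log (u x t + l)) p
      ((hW.differentiableOn (by simp) p hp).differentiableAt (hVo.mem_nhds hp))).fderiv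
  have i1 := slice_integrable N ψ O I hO hψ.continuous hψk hψO _ (qden_cont N O I l u ψ hO hI hU hv hψ) t ht
  have i2 := slice_integrable N (fun x => ψ x ^ 2) O I hO (hψ.continuous.pow 2) hψ2k hψ2s _ hcW t ht
  simp only at i2
  have i3 : Integrable (fun x => ‖fderiv ℝ ψ x‖ ^ 2) := by
    refine ((hψ.continuous_fderiv (by simp)).norm.pow 2).integrable_of_hasCompactSupport ?_
    exact hcs_sq _ (fderiv_norm_hcs N ψ hψk)
  have hb3 : ∫ x, ‖fderiv ℝ ψ x‖ ^ 2 ≤ (C₀ / r) ^ 2 * ((3 * r / 2) ^ N * volume.real (ball (0 : E N) 1)) := by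
    have e : ∫ x in ball x₀ (3 * r / 2), ‖fderiv ℝ ψ x‖ ^ 2 = ∫ x, ‖fderiv ℝ ψ x‖ ^ 2 :=
      setIntegral_eq_integral_of_forall_compl_eq_zero fun x hx => by
        have z1 : ψ =ᶠ[nhds x] 0 := notMem_tsupport_iff_eventuallyEq.1 fun h => hx (hψs h)
        rw [z1.fderiv_eq]; simp
    rw [← e]
    have h := setIntegral_mono_on (i3.integrableOn (s := ball x₀ (3 * r / 2)))
      (integrableOn_const (C := (C₀ / r) ^ 2) (measure_ball_lt_top.ne)) measurableSet_ball
      (fun x _ => pow_le_pow_left₀ (norm_nonneg _) (hg x) 2)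
    refine h.trans (le_of_eq ?_)
    have hω := ball_unit_pos N
    rw [setIntegral_const, Measure.real, ball_vol N hN x₀ (3 * r / 2) (by positivity),
      ENNReal.toReal_ofReal (by positivity), smul_eq_mul, mul_comm]
  have hpt : ∀ x, ψ x * qden N u l ψ (x, t) ≤
      -(1 / 2) * (ψ x ^ 2 * ‖fderiv ℝ (fun y => Real.log (u y t + l)) x‖ ^ 2) + 2 * ‖fderiv ℝ ψ x‖ ^ 2 := by
    intro x
    by_cases hx : x ∈ O
    · have hd := (slice_fderiv N u (x, t) ((hU.differentiableOn (by simp) (x, t) ⟨hx, ht⟩).differentiableAt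
          (hVo.mem_nhds ⟨hx, ht⟩))).differentiableAt.hasFDerivAt
      simp only at hd
      have hvx : 0 < u x t + l := hv x hx t ht
      have h1 := ((hd.add_const l).log hvx.ne').fderiv
      rw [h1, norm_smul, mul_pow]
      unfold qden
      simp only
      set L := fderiv ℝ (fun y => u y t) x
      have h2 : L (gradient ψ x) ≤ ‖L‖ * ‖fderiv ℝ ψ x‖ := by
        have := (le_abs_self _).trans (L.le_opNorm (gradient ψ x))
        rwa [norm_grad] at this
      have h2' : -(L (gradient ψ x)) ≤ ‖L‖ * ‖fderiv ℝ ψ x‖ := by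
        have := (neg_le_abs _).trans (L.le_opNorm (gradient ψ x))
        rwa [norm_grad] at this
      set g := ‖fderiv ℝ ψ x‖
      set v := u x t + l
      have h3 : |L (gradient ψ x)| ≤ ‖L‖ * g := abs_le.2 ⟨by linarith, h2⟩
      have h4 : ψ x * v⁻¹ * L (gradient ψ x) ≤ |ψ x * v⁻¹| * (‖L‖ * g) := by
        refine (le_abs_self _).trans ?_
        rw [abs_mul]; gcongr
      have h5 : |ψ x * v⁻¹| ^ 2 = ψ x ^ 2 * (v⁻¹) ^ 2 := by rw [sq_abs, mul_pow]
      have h6 : ‖v⁻¹‖ ^ 2 = (v⁻¹) ^ 2 := by rw [Real.norm_eq_abs, sq_abs]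
      have e1 : ψ x * (2 / v * L (gradient ψ x) - ψ x / v ^ 2 * ‖L‖ ^ 2) =
        2 * (ψ x * v⁻¹ * L (gradient ψ x)) - |ψ x * v⁻¹| ^ 2 * ‖L‖ ^ 2 := by
        rw [h5]; field_simp
      have e2 : ψ x ^ 2 * (‖v⁻¹‖ ^ 2 * ‖L‖ ^ 2) = |ψ x * v⁻¹| ^ 2 * ‖L‖ ^ 2 := by
        rw [h5, h6]; ring
      rw [e1, e2]
      nlinarith [sq_nonneg (|ψ x * v⁻¹| * ‖L‖ - 2 * g)]
    · have : ψ x = 0 := image_eq_zero_of_notMem_tsupport fun h => hx (hψO h)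
      simp [this]
  calc _ ≤ ∫ x, (-(1 / 2) * (ψ x ^ 2 * ‖fderiv ℝ (fun y => Real.log (u y t + l)) x‖ ^ 2) + 2 * ‖fderiv ℝ ψ x‖ ^ 2) :=
        integral_mono i1 ((i2.const_mul _).fun_add (i3.const_mul _)) hpt
    _ = -(1 / 2) * (∫ x, ψ x ^ 2 * ‖fderiv ℝ (fun y => Real.log (u y t + l)) x‖ ^ 2) + 2 * ∫ x, ‖fderiv ℝ ψ x‖ ^ 2 := by
        rw [integral_add (i2.const_mul _) (i3.const_mul _), integral_const_mul, integral_const_mul]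
    _ ≤ _ := by linarith

lemma one_d (a t₀ κ lam : ℝ) (B B' m : ℝ → ℝ) (hκ : 0 < κ) (hlam : 0 < lam)
    (hB : ∀ t ∈ Ioc a t₀, HasDerivAt B (B' t) t) (hB' : ∀ t ∈ Ioc a t₀, 0 ≤ B' t)
    (hm : ∀ t ∈ Ioc a t₀, B t ≤ B t₀ → m t * (lam + B t₀ - B t) ^ 2 ≤ κ * B' t) :
    ∫⁻ t in Ioo a t₀, ENNReal.ofReal (m t) ≤ ENNReal.ofReal (κ / lam) := by
  have key : ∀ t₁, a < t₁ → t₁ ≤ t₀ → ∫⁻ t in Ioc t₁ t₀, ENNReal.ofReal (m t) ≤ ENNReal.ofReal (κ / lam) := by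
    intro t₁ h1 h2
    have hsub : Icc t₁ t₀ ⊆ Ioc a t₀ := fun t ht => ⟨h1.trans_le ht.1, ht.2⟩
    have hBc : ContinuousOn B (Icc t₁ t₀) := fun t ht => (hB t (hsub ht)).continuousAt.continuousWithinAt
    have hmono : MonotoneOn B (Icc t₁ t₀) := by
      refine monotoneOn_of_deriv_nonneg (convex_Icc _ _) hBc ?_ ?_
      · intro t ht
        exact (hB t (hsub (interior_subset ht))).differentiableAt.differentiableWithinAt
      · intro t ht
        rw [(hB t (hsub (interior_subset ht))).deriv]
        exact hB' t (hsub (interior_subset ht))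
    have hle : ∀ t ∈ Icc t₁ t₀, B t ≤ B t₀ := fun t ht => hmono ht (right_mem_Icc.2 h2) ht.2
    have hg : ∀ t ∈ Icc t₁ t₀, 0 < lam + B t₀ - B t := fun t ht => by linarith [hle t ht]
    set H : ℝ → ℝ := fun t => κ * (lam + B t₀ - B t)⁻¹ with hH
    set H' : ℝ → ℝ := fun t => κ * (B' t / (lam + B t₀ - B t) ^ 2) with hH'
    have hHd : ∀ t ∈ Icc t₁ t₀, HasDerivAt H (H' t) t := by
      intro t ht
      have := (((hB t (hsub ht)).const_sub (lam + B t₀)).fun_inv (hg t ht).ne').const_mul κ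
      simpa [hH, hH'] using this
    have hHc : ContinuousOn H (Icc t₁ t₀) := fun t ht => (hHd t ht).continuousAt.continuousWithinAt
    have hH0 : ∀ t ∈ Icc t₁ t₀, 0 ≤ H' t := fun t ht => by
      have := hB' t (hsub ht); simp only [hH']; positivity
    have hint : IntegrableOn H' (Ioc t₁ t₀) :=
      intervalIntegral.integrableOn_deriv_of_nonneg hHc (fun t ht => hHd t (Ioo_subset_Icc_self ht))
        (fun t ht => hH0 t (Ioo_subset_Icc_self ht))
    have hftc : ∫ t in Ioc t₁ t₀, H' t = H t₀ - H t₁ := by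
      rw [← intervalIntegral.integral_of_le h2]
      exact intervalIntegral.integral_eq_sub_of_hasDerivAt_of_le h2 hHc
        (fun t ht => hHd t (Ioo_subset_Icc_self ht)) ((intervalIntegrable_iff_integrableOn_Ioc_of_le h2).2 hint)
    calc ∫⁻ t in Ioc t₁ t₀, ENNReal.ofReal (m t) ≤ ∫⁻ t in Ioc t₁ t₀, ENNReal.ofReal (H' t) := by
          refine setLIntegral_mono' measurableSet_Ioc fun t ht => ENNReal.ofReal_le_ofReal ?_
          have ht' := Ioc_subset_Icc_self ht
          have := hm t (hsub ht') (hle t ht')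
          have hgt := hg t ht'
          simp only [hH']
          rw [← mul_div_assoc, le_div_iff₀ (by positivity)]
          exact this
      _ = ENNReal.ofReal (∫ t in Ioc t₁ t₀, H' t) := by
          refine (ofReal_integral_eq_lintegral_ofReal hint ?_).symm
          exact (ae_restrict_iff' measurableSet_Ioc).2 (.of_forall fun t ht => hH0 t (Ioc_subset_Icc_self ht))
      _ ≤ _ := by
          rw [hftc]
          refine ENNReal.ofReal_le_ofReal ?_
          have e1 : H t₀ = κ / lam := by simp [hH, div_eq_mul_inv]
          have e2 : 0 ≤ H t₁ := by
            have := hg t₁ (left_mem_Icc.2 h2); simp only [hH]; positivity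
          linarith
  by_cases hat : a < t₀
  swap
  · rw [Ioo_eq_empty hat]; simp
  have hu : Ioo a t₀ ⊆ ⋃ n : ℕ, Ioc (a + (t₀ - a) / ((n : ℝ) + 1)) t₀ := by
    intro t ht
    obtain ⟨n, hn⟩ := exists_nat_gt ((t₀ - a) / (t - a))
    have hta : 0 < t - a := by linarith [ht.1]
    refine mem_iUnion.2 ⟨n, ?_, ht.2.le⟩
    rw [div_lt_iff₀ hta] at hn
    have : (t₀ - a) / ((n : ℝ) + 1) < t - a := by
      rw [div_lt_iff₀ (by positivity)]; nlinarith
    linarith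
  refine (lintegral_mono_set hu).trans ?_
  rw [setLIntegral_iUnion_of_directed]
  · refine iSup_le fun n => key _ ?_ ?_
    · have : 0 < (t₀ - a) / ((n : ℝ) + 1) := div_pos (by linarith) (by positivity)
      linarith
    · have : (t₀ - a) / ((n : ℝ) + 1) ≤ t₀ - a := div_le_self (by linarith) (by linarith [(Nat.cast_nonneg n : (0:ℝ) ≤ n)])
      linarith
  · refine Monotone.directed_le fun i j hij => Ioc_subset_Ioc_left ?_
    have h1 : (i : ℝ) ≤ j := by exact_mod_cast hij
    have h0 : 0 ≤ t₀ - a := by linarith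
    gcongr

lemma psi_mass (N : ℕ) (hN : 2 ≤ N) (x₀ : E N) (r : ℝ) (ψ : E N → ℝ) (hr : 0 < r)
    (hψ : Continuous ψ) (hψk : HasCompactSupport ψ) (hψs : tsupport ψ ⊆ ball x₀ (3 * r / 2))
    (hψ0 : ∀ x, 0 ≤ ψ x) (hψ1 : ∀ x, ψ x ≤ 1) (hψr : ∀ x ∈ ball x₀ r, ψ x = 1) :
    r ^ N * volume.real (ball (0 : E N) 1) ≤ ∫ x, ψ x ^ 2 ∧
      ∫ x, ψ x ^ 2 ≤ (3 * r / 2) ^ N * volume.real (ball (0 : E N) 1) := by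
  have hω := ball_unit_pos N
  have hi : Integrable (fun x => ψ x ^ 2) :=
    (hψ.pow 2).integrable_of_hasCompactSupport (hcs_sq _ hψk)
  constructor
  · refine le_trans (le_of_eq ?_) (setIntegral_le_integral (s := ball x₀ r) hi (.of_forall fun x => by positivity))
    rw [setIntegral_congr_fun (g := fun _ => (1:ℝ)) measurableSet_ball fun x hx => by simp [hψr x hx]]
    have hb : volume.real (ball x₀ r) = r ^ N * volume.real (ball (0 : E N) 1) := by
      rw [measureReal_def, ball_vol N hN x₀ r hr, ENNReal.toReal_ofReal (by positivity)]
    rw [setIntegral_const, hb]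
    simp
  · have e : ∫ x in ball x₀ (3 * r / 2), ψ x ^ 2 = ∫ x, ψ x ^ 2 :=
      setIntegral_eq_integral_of_forall_compl_eq_zero fun x hx => by
        rw [image_eq_zero_of_notMem_tsupport fun h => hx (hψs h)]; simp
    rw [← e]
    have h := setIntegral_mono_on (hi.integrableOn (s := ball x₀ (3 * r / 2)))
      (integrableOn_const (C := (1:ℝ)) (measure_ball_lt_top.ne)) measurableSet_ball
      (fun x _ => pow_le_one₀ (hψ0 x) (hψ1 x))
    refine h.trans (le_of_eq ?_)
    rw [setIntegral_const, Measure.real, ball_vol N hN x₀ (3 * r / 2) (by positivity),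
      ENNReal.toReal_ofReal (by positivity)]
    simp

lemma level_core (N : ℕ) (hN : 2 ≤ N) (x₀ : E N) (r R t₀ l C1 : ℝ) (u : E N → ℝ → ℝ) (ψ : E N → ℝ)
    (hr : 0 < r) (hrR : 3 * r / 2 < R) (hC1 : 0 ≤ C1)
    (hum : Measurable (fun p : E N × ℝ => u p.1 p.2))
    (hU : ContDiffOn ℝ (⊤ : ℕ∞) (fun p : E N × ℝ => u p.1 p.2) (ball x₀ R ×ˢ Ioo (t₀ - r ^ 2) (t₀ + r ^ 2)))
    (hv : ∀ x ∈ ball x₀ R, ∀ t ∈ Ioo (t₀ - r ^ 2) (t₀ + r ^ 2), 0 < u x t + l)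
    (hψ : ContDiff ℝ (⊤ : ℕ∞) ψ) (hψk : HasCompactSupport ψ)
    (hψs : tsupport ψ ⊆ ball x₀ (3 * r / 2))
    (hψ0 : ∀ x, 0 ≤ ψ x) (hψ1 : ∀ x, ψ x ≤ 1)
    (hgm : ∃ g : ℝ → ℝ, AntitoneOn g (Set.Ici 0) ∧ ∀ x, ψ x = g ‖x - x₀‖)
    (hψr : ∀ x ∈ ball x₀ r, ψ x = 1)
    (hen : ∀ t ∈ Ioo (t₀ - r ^ 2) (t₀ + r ^ 2),
      1 / 2 * (∫ x, ψ x ^ 2 * ‖fderiv ℝ (fun y => Real.log (u y t + l)) x‖ ^ 2) ≤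
        (∫ x, ψ x ^ 2 * (fderiv ℝ (fun p : E N × ℝ => u p.1 p.2) (x, t) (0, 1) / (u x t + l))) + C1 * r ^ N / r ^ 2)
    (lam : ℝ) (hlam : 0 < lam) :
    volume {p : E N × ℝ | p ∈ (ball x₀ r) ×ˢ Ioo (t₀ - r ^ 2) t₀ ∧
        lam + (∫ x, ψ x ^ 2 * Real.log (u x t₀ + l)) / (∫ x, ψ x ^ 2) <
          Real.log (u p.1 p.2 + l) + C1 / volume.real (ball (0 : E N) 1) / r ^ 2 * (p.2 - t₀)} ≤
      ENNReal.ofReal (9 * 3 ^ N * (3 / 2) ^ N * volume.real (ball (0 : E N) 1) * r ^ (N + 2) / lam) := by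
  set O := ball x₀ R with hOd
  set I := Ioo (t₀ - r ^ 2) (t₀ + r ^ 2) with hId
  set ω := volume.real (ball (0 : E N) 1) with hωd
  have hω : 0 < ω := ball_unit_pos N
  have hO : IsOpen O := isOpen_ball
  have hI : IsOpen I := isOpen_Ioo
  have hVo : IsOpen (O ×ˢ I) := hO.prod hI
  have hψO : tsupport ψ ⊆ O := hψs.trans (ball_subset_ball hrR.le)
  have hrO : ball x₀ r ⊆ O := ball_subset_ball (by linarith)
  have hψ2s : tsupport (fun x => ψ x ^ 2) ⊆ O := by
    refine (closure_mono fun x hx => ?_).trans hψO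
    simp only [Function.mem_support] at hx ⊢
    exact fun h => hx (by simp [h])
  have hψ2k : HasCompactSupport (fun x => ψ x ^ 2) := hcs_sq _ hψk
  obtain ⟨hm1, hm2⟩ := psi_mass N hN x₀ r ψ hr hψ.continuous hψk hψs hψ0 hψ1 hψr
  set Ψ := ∫ x, ψ x ^ 2 with hΨd
  have hΨ : 0 < Ψ := lt_of_lt_of_le (by positivity) hm1
  set w : E N → ℝ → ℝ := fun x t => Real.log (u x t + l) with hwd
  have hW : ContDiffOn ℝ (⊤ : ℕ∞) (fun p : E N × ℝ => w p.1 p.2) (O ×ˢ I) := logW_smooth N O I l u hU hv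
  have hwm : Measurable (fun p : E N × ℝ => w p.1 p.2) := Real.measurable_log.comp (hum.add_const l)
  set A : ℝ → ℝ := fun t => (∫ x, ψ x ^ 2 * w x t) / Ψ with hA
  set c := C1 / ω / r ^ 2 with hc
  set G : ℝ → ℝ := fun t => ∫ x, ψ x ^ 2 * (fderiv ℝ (fun p : E N × ℝ => u p.1 p.2) (x, t) (0, 1) / (u x t + l)) with hG
  have hAd : ∀ t ∈ I, HasDerivAt A (G t / Ψ) t := by
    intro t ht
    have h := (param_deriv N (fun x => ψ x ^ 2) O I hO hI (hψ.continuous.pow 2) hψ2k hψ2s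
      (fun p : E N × ℝ => w p.1 p.2) (hW.of_le (by simp)) t ht).div_const Ψ
    have hGe : G t = ∫ x, ψ x ^ 2 * fderiv ℝ (fun p : E N × ℝ => w p.1 p.2) (x, t) (0, 1) := ?_
    · rw [hGe]; exact h
    refine integral_congr_ae (.of_forall fun x => ?_)
    show ψ x ^ 2 * (fderiv ℝ (fun p : E N × ℝ => u p.1 p.2) (x, t) (0, 1) / (u x t + l)) = _
    by_cases hx : x ∈ O
    · have hd := ((hU.differentiableOn (by simp) (x, t) ⟨hx, ht⟩).differentiableAt (hVo.mem_nhds ⟨hx, ht⟩)).hasFDerivAt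
      have hd2 : HasFDerivAt (fun p : E N × ℝ => u p.1 p.2 + l) (fderiv ℝ (fun p : E N × ℝ => u p.1 p.2) (x, t)) (x, t) :=
        hd.add_const l
      have h1 := (hd2.log (hv x hx t ht).ne').fderiv
      simp only [hwd]
      rw [h1]
      simp [div_eq_inv_mul]
    · have : ψ x = 0 := image_eq_zero_of_notMem_tsupport fun h => hx (hψO h)
      simp [this]
  set B : ℝ → ℝ := fun t => A t + c * (t - t₀) with hB
  have hBd : ∀ t ∈ I, HasDerivAt B (G t / Ψ + c) t := by
    intro t ht
    have h1 : HasDerivAt (fun t => c * (t - t₀)) c t := by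
      simpa using ((hasDerivAt_id t).sub_const t₀).const_mul c
    exact (hAd t ht).add h1
  set V : ℝ → ℝ := fun t => ∫ x, ψ x ^ 2 * (w x t - A t) ^ 2 with hV
  have hV0 : ∀ t, 0 ≤ V t := fun t => integral_nonneg fun x => by positivity
  set κ := 9 * 3 ^ N * r ^ 2 * Ψ with hκd
  have hκ : 0 < κ := by positivity
  have hVB : ∀ t ∈ I, V t ≤ κ * (G t / Ψ + c) := by
    intro t ht
    have hws : ContDiffOn ℝ 1 (fun x => w x t) O := by
      have := ContDiffOn.comp (g := fun p : E N × ℝ => w p.1 p.2) (f := fun x : E N => (x, t)) (s := O)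
        (hW.of_le (by simp : (1 : WithTop ℕ∞) ≤ _)) (contDiff_id.prodMk contDiff_const).contDiffOn (fun x hx => ⟨hx, ht⟩)
      exact this
    have hp := poincare N hN x₀ r R hr hrR ψ (fun x => w x t) hψ.continuous hψk hψs hψ0 hψ1 hgm hm1 hws
    have he := hen t ht
    set D := ∫ x, ψ x ^ 2 * ‖fderiv ℝ (fun y => w y t) x‖ ^ 2 with hD
    have hp' : V t ≤ 9 * 3 ^ N / 2 * r ^ 2 * D := hp
    have he' : 1 / 2 * D ≤ G t + C1 * r ^ N / r ^ 2 := he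
    have h3 : C1 * r ^ N / r ^ 2 ≤ c * Ψ := by
      have : C1 * r ^ N / r ^ 2 = c * (r ^ N * ω) := by rw [hc]; field_simp
      rw [this]
      exact mul_le_mul_of_nonneg_left hm1 (by positivity)
    have h4 : κ * (G t / Ψ + c) = 9 * 3 ^ N * r ^ 2 * (G t + c * Ψ) := by
      rw [hκd]; field_simp
    rw [h4]
    have h5 : 1 / 2 * D ≤ G t + c * Ψ := by linarith
    calc V t ≤ 9 * 3 ^ N * r ^ 2 * (1 / 2 * D) := by linarith
      _ ≤ _ := mul_le_mul_of_nonneg_left h5 (by positivity)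
  have hsub : Ioc (t₀ - r ^ 2) t₀ ⊆ I := fun t ht => ⟨ht.1, by nlinarith [ht.2]⟩
  set thr := lam + A t₀ with hthr
  set Z : ℝ → Set (E N) := fun t => {x | x ∈ ball x₀ r ∧ thr < w x t + c * (t - t₀)} with hZ
  have hwt : ∀ t, Measurable (fun x => w x t) := fun t => hwm.comp (measurable_id.prodMk measurable_const)
  have hZm : ∀ t, MeasurableSet (Z t) := fun t =>
    measurableSet_ball.inter (measurableSet_lt measurable_const ((hwt t).add_const _))
  have hZf : ∀ t, volume (Z t) ≠ ⊤ := fun t =>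
    ((measure_mono (fun x hx => hx.1)).trans_lt (measure_ball_lt_top (x := x₀) (r := r))).ne
  have hBt0 : B t₀ = A t₀ := by simp [hB]
  have h1d := one_d (t₀ - r ^ 2) t₀ κ lam B (fun t => G t / Ψ + c) (fun t => volume.real (Z t)) hκ hlam
    (fun t ht => hBd t (hsub ht))
    (fun t ht => by
      have := (hV0 t).trans (hVB t (hsub ht))
      exact nonneg_of_mul_nonneg_right this hκ)
    (fun t ht hBt => by
      refine le_trans ?_ (hVB t (hsub ht))
      have hg0 : 0 < lam + B t₀ - B t := by linarith
      have hint : Integrable (fun x => ψ x ^ 2 * (w x t - A t) ^ 2) :=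
        slice_integrable N (fun x => ψ x ^ 2) O I hO (hψ.continuous.pow 2) hψ2k hψ2s
          (fun p => (w p.1 p.2 - A t) ^ 2) ((hW.continuousOn.sub continuousOn_const).pow 2) t (hsub ht)
      have h1 : ∫ x in Z t, ψ x ^ 2 * (w x t - A t) ^ 2 ≤ V t :=
        setIntegral_le_integral hint (.of_forall fun x => by positivity)
      refine le_trans ?_ h1
      have h2 := setIntegral_mono_on (integrableOn_const (C := (lam + B t₀ - B t) ^ 2) (hZf t))
        hint.integrableOn (hZm t) (fun x hx => ?_)
      · rw [setIntegral_const, smul_eq_mul] at h2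
        exact h2
      · rw [hψr x hx.1, one_pow, one_mul]
        refine pow_le_pow_left₀ hg0.le ?_ 2
        have := hx.2
        rw [hBt0]
        simp only [hB]
        linarith)
  have hZZ : MeasurableSet {p : E N × ℝ | p ∈ (ball x₀ r) ×ˢ Ioo (t₀ - r ^ 2) t₀ ∧
      thr < w p.1 p.2 + c * (p.2 - t₀)} := by
    have h2 : MeasurableSet {p : E N × ℝ | thr < w p.1 p.2 + c * (p.2 - t₀)} :=
      measurableSet_lt measurable_const (hwm.add ((measurable_snd.sub_const t₀).const_mul c))
    exact (measurableSet_ball.prod measurableSet_Ioo).inter h2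
  refine le_trans ?_ (h1d.trans (ENNReal.ofReal_le_ofReal ?_))
  · change volume {p : E N × ℝ | p ∈ (ball x₀ r) ×ˢ Ioo (t₀ - r ^ 2) t₀ ∧ thr < w p.1 p.2 + c * (p.2 - t₀)} ≤ _
    rw [Measure.volume_eq_prod, Measure.prod_apply_symm hZZ, ← lintegral_indicator measurableSet_Ioo]
    refine lintegral_mono fun t => ?_
    by_cases ht : t ∈ Ioo (t₀ - r ^ 2) t₀
    · rw [indicator_of_mem ht, Measure.real, ENNReal.ofReal_toReal (hZf t)]
      exact measure_mono fun x hx => ⟨hx.1.1, hx.2⟩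
    · rw [indicator_of_notMem ht]
      refine le_of_eq ?_
      convert measure_empty (μ := (volume : Measure (E N)))
      ext x
      simp only [mem_preimage, mem_ofPred_eq, mem_empty_iff_false, iff_false]
      exact fun h => ht h.1.2
  · refine div_le_div_of_nonneg_right ?_ hlam.le
    calc κ ≤ 9 * 3 ^ N * r ^ 2 * ((3 * r / 2) ^ N * ω) := mul_le_mul_of_nonneg_left hm2 (by positivity)
      _ = _ := by
        have : (3 * r / 2) ^ N = (3 / 2) ^ N * r ^ N := by rw [← mul_pow]; congr 1; ring
        rw [this]; ring

theorem stmt_15 (N : ℕ) (hN : 2 ≤ N) (s Λ C₀ : ℝ) (hs : s ∈ Set.Ioo (0 : ℝ) 1)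
    (hΛ : 1 ≤ Λ) (hC₀ : 0 < C₀) :
    ∃ C : ℝ, 0 < C ∧
      ∀ (T : ℝ) (Ω : Set (E N)) (K : E N → E N → ℝ → ℝ) (u : E N → ℝ → ℝ)
        (x₀ : E N) (R r t₀ d l : ℝ) (ψ : E N → ℝ),
        0 < T → IsOpen Ω → Bornology.IsBounded Ω →
        KernelOK N s Λ T K → IsWeakSupersolution N T K Ω u →
        Metric.ball x₀ R ⊆ Ω → Set.Ioo (t₀ - r ^ 2) (t₀ + r ^ 2) ⊆ Set.Ioo 0 T →
        (∀ x ∈ Metric.ball x₀ R, ∀ t ∈ Set.Ioo (t₀ - r ^ 2) (t₀ + r ^ 2), 0 ≤ u x t) →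
        0 < r → r ≤ 1 → r < R / 2 → 0 < d →
        l = (r / R) ^ 2 * tailInfty N s (uminus N u) x₀ R (t₀ - r ^ 2) (t₀ + r ^ 2) + d →
        ContDiff ℝ (⊤ : ℕ∞) ψ → HasCompactSupport ψ →
        tsupport ψ ⊆ Metric.ball x₀ (3 * r / 2) →
        (∀ x, 0 ≤ ψ x) → (∀ x, ψ x ≤ 1) →
        (∃ g : ℝ → ℝ, AntitoneOn g (Set.Ici 0) ∧ ∀ x, ψ x = g ‖x - x₀‖) →
        (∀ x ∈ Metric.ball x₀ r, ψ x = 1) →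
        (∀ x ∈ Metric.ball x₀ (3 * r / 2), ‖gradient ψ x‖ ≤ C₀ / r) →
        ∀ lam : ℝ, 0 < lam →
          volume {p : E N × ℝ |
              p ∈ (Metric.ball x₀ r) ×ˢ Set.Ioo (t₀ - r ^ 2) t₀ ∧
              lam -
                  (-(∫ x in Metric.ball x₀ (3 * r / 2), Real.log (u x t₀ + l) * ψ x ^ 2) /
                    ∫ x in Metric.ball x₀ (3 * r / 2), ψ x ^ 2) <
                Real.log (u p.1 p.2 + l)} ≤
            ENNReal.ofReal (C * r ^ (N + 2) / lam) := by
  obtain ⟨C, hC, hE⟩ := energy_weak N hN s Λ C₀ hs hΛ hC₀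
  set ω := volume.real (ball (0 : E N) 1) with hωd
  have hω : 0 < ω := ball_unit_pos N
  set C1 := C + 2 * C₀ ^ 2 * (3 / 2) ^ N * ω with hC1d
  have hC1 : 0 ≤ C1 := by positivity
  set C2 := 9 * 3 ^ N * (3 / 2) ^ N * ω with hC2d
  have hC2 : 0 < C2 := by positivity
  refine ⟨2 * C2 + 2 * C1, by positivity, ?_⟩
  intro T Ω K u x₀ R r t₀ d l ψ hT hΩ hΩb hK hu hOΩ hIT hu0 hr hr1 hrR hd hl hψ hψk hψs hψ0 hψ1 hgm hψr hgrad lam hlam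
  have hR : 0 < R := by linarith
  have hr2 : 0 < r ^ 2 := by positivity
  obtain ⟨S, hS0, hSt, hS⟩ := tail_facts N hN s hs x₀ R (t₀ - r ^ 2) (t₀ + r ^ 2) T hR (by linarith) hIT u hu.1 hu.2.1
  have hl' : l = r ^ 2 * S + d := by
    rw [hl, hSt]; field_simp
  have hl0 : 0 < l := by rw [hl']; positivity
  have hSl : r ^ 2 * S ≤ l := by linarith
  obtain ⟨hf, hL⟩ := psi_lip N ψ x₀ r C₀ hr hC₀ hψ hψs hgrad
  have hU := hu.2.2.1.mono (prod_mono hOΩ hIT)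
  have hv : ∀ x ∈ ball x₀ R, ∀ t ∈ Ioo (t₀ - r ^ 2) (t₀ + r ^ 2), 0 < u x t + l := fun x hx t ht => by
    linarith [hu0 x hx t ht]
  have hrR' : 3 * r / 2 < R := by linarith
  have hen : ∀ t ∈ Ioo (t₀ - r ^ 2) (t₀ + r ^ 2),
      1 / 2 * (∫ x, ψ x ^ 2 * ‖fderiv ℝ (fun y => Real.log (u y t + l)) x‖ ^ 2) ≤
        (∫ x, ψ x ^ 2 * (fderiv ℝ (fun p : E N × ℝ => u p.1 p.2) (x, t) (0, 1) / (u x t + l))) + C1 * r ^ N / r ^ 2 := by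
    intro t ht
    have h1 := hE T Ω K u x₀ R r (t₀ - r ^ 2) (t₀ + r ^ 2) l S ψ hK hu hOΩ hIT hu0 hr hr1 hrR hl0 hS0 hSl hS hψ hψk hψs
      hψ0 hψ1 hL t ht
    have h2 := Q_bound N hN x₀ r R l C₀ (Ioo (t₀ - r ^ 2) (t₀ + r ^ 2)) u ψ hr hrR' isOpen_Ioo hU hv hψ hψk hψs hf t ht
    have h3 : C1 * r ^ N / r ^ 2 = C * r ^ N / r ^ 2 + 2 * ((C₀ / r) ^ 2 * ((3 * r / 2) ^ N * ω)) := by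
      have : (3 * r / 2) ^ N = (3 / 2) ^ N * r ^ N := by rw [← mul_pow]; congr 1; ring
      rw [this, hC1d]; field_simp
    rw [h3]
    linarith
  have e1 : ∫ x in ball x₀ (3 * r / 2), Real.log (u x t₀ + l) * ψ x ^ 2 = ∫ x, ψ x ^ 2 * Real.log (u x t₀ + l) := by
    rw [setIntegral_eq_integral_of_forall_compl_eq_zero]
    · congr 1; ext x; ring
    · intro x hx
      rw [image_eq_zero_of_notMem_tsupport fun h => hx (hψs h)]; simp
  have e2 : ∫ x in ball x₀ (3 * r / 2), ψ x ^ 2 = ∫ x, ψ x ^ 2 :=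
    setIntegral_eq_integral_of_forall_compl_eq_zero fun x hx => by
      rw [image_eq_zero_of_notMem_tsupport fun h => hx (hψs h)]; simp
  rw [e1, e2]
  set a := (∫ x, ψ x ^ 2 * Real.log (u x t₀ + l)) / ∫ x, ψ x ^ 2 with ha
  have e3 : lam - (-(∫ x, ψ x ^ 2 * Real.log (u x t₀ + l)) / ∫ x, ψ x ^ 2) = lam + a := by
    rw [ha, neg_div]; ring
  rw [e3]
  by_cases hcase : 2 * (C1 / ω) < lam
  · have h := level_core N hN x₀ r R t₀ l C1 u ψ hr hrR' hC1 hu.1 hU hv hψ hψk hψs hψ0 hψ1 hgm hψr hen (lam / 2) (by positivity)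
    refine le_trans (measure_mono ?_) (h.trans (ENNReal.ofReal_le_ofReal ?_))
    · rintro p ⟨hp1, hp2⟩
      refine ⟨hp1, ?_⟩
      have ht1 : t₀ - r ^ 2 < p.2 := hp1.2.1
      have h4 : -(C1 / ω) ≤ C1 / ω / r ^ 2 * (p.2 - t₀) := by
        have : C1 / ω / r ^ 2 * (-(r ^ 2)) ≤ C1 / ω / r ^ 2 * (p.2 - t₀) :=
          mul_le_mul_of_nonneg_left (by linarith) (by positivity)
        refine le_trans (le_of_eq ?_) this
        field_simp
      show lam / 2 + a < Real.log (u p.1 p.2 + l) + C1 / ω / r ^ 2 * (p.2 - t₀)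
      linarith
    · have : 9 * 3 ^ N * (3 / 2) ^ N * ω * r ^ (N + 2) / (lam / 2) = 2 * C2 * r ^ (N + 2) / lam := by
        rw [hC2d]; field_simp
      rw [this]
      gcongr
      linarith
  · refine le_trans (measure_mono (t := ball x₀ r ×ˢ Ioo (t₀ - r ^ 2) t₀) fun p hp => hp.1) ?_
    rw [Measure.volume_eq_prod, Measure.prod_prod, ball_vol N hN x₀ r hr, Real.volume_Ioo,
      ← ENNReal.ofReal_mul (by positivity)]
    refine ENNReal.ofReal_le_ofReal ?_
    rw [le_div_iff₀ hlam]
    have h5 : lam * ω ≤ 2 * C1 := by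
      have := not_lt.1 hcase
      rw [← mul_div_assoc, le_div_iff₀ hω] at this
      exact this
    have : r ^ N * ω * (t₀ - (t₀ - r ^ 2)) * lam = (lam * ω) * r ^ (N + 2) := by ring
    rw [this]
    gcongr
    linarith
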